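/- Every ontology-mediated atomic query q = (O, A), where O is an LTL_krom^□○ ontology and A an atomic concept, is FO(<,≡)-rewritable: there is a constant-free FO(<,≡)-formula q(t) with one free variable t such that ans(q, A) = {ℓ ∈ tem(A) : S_A ⊨ q(ℓ)} for every data instance A. -/

import Mathlib

namespace LTLOMQ

/-! ## Temporal concepts (LTL formulas) and their semantics over (ℤ,<) -/

/-- Temporal concepts: arbitrary LTL formulas over atomic concepts indexed by `ℕ`. -/
inductive TC : Type where
  | top : TC
  | atom : ℕ → TC
  | neg : TC → TC
  | and : TC → TC → TC
  | or : TC → TC → TC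
  | nextF : TC → TC
  | diamF : TC → TC
  | boxF : TC → TC
  | untl : TC → TC → TC
  | nextP : TC → TC
  | diamP : TC → TC
  | boxP : TC → TC
  | since : TC → TC → TC

/-- A temporal interpretation assigns to each atomic concept a subset of ℤ. -/
abbrev Itp : Type := ℕ → Set ℤ

/-- The extension of a temporal concept in an interpretation
(strict semantics over `(ℤ,<)`). -/
def TC.sem (M : Itp) : TC → Set ℤ
  | .top => Set.univ
  | .atom a => M a
  | .neg C => (TC.sem M C)ᶜ
  | .and C D => TC.sem M C ∩ TC.sem M D
  | .or C D => TC.sem M C ∪ TC.sem M D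
  | .nextF C => {n | n + 1 ∈ TC.sem M C}
  | .diamF C => {n | ∃ k, n < k ∧ k ∈ TC.sem M C}
  | .boxF C => {n | ∀ k, n < k → k ∈ TC.sem M C}
  | .untl C D => {n | ∃ k, n < k ∧ k ∈ TC.sem M D ∧ ∀ m, n < m → m < k → m ∈ TC.sem M C}
  | .nextP C => {n | n - 1 ∈ TC.sem M C}
  | .diamP C => {n | ∃ k, k < n ∧ k ∈ TC.sem M C}
  | .boxP C => {n | ∀ k, k < n → k ∈ TC.sem M C}
  | .since C D => {n | ∃ k, k < n ∧ k ∈ TC.sem M D ∧ ∀ m, k < m → m < n → m ∈ TC.sem M C}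

/-- Basic temporal concepts: built from atomic concepts using ○F, ○P, □F, □P. -/
inductive TC.IsBasic : TC → Prop
  | atom (a : ℕ) : TC.IsBasic (.atom a)
  | nextF {C : TC} : TC.IsBasic C → TC.IsBasic (.nextF C)
  | nextP {C : TC} : TC.IsBasic C → TC.IsBasic (.nextP C)
  | boxF {C : TC} : TC.IsBasic C → TC.IsBasic (.boxF C)
  | boxP {C : TC} : TC.IsBasic C → TC.IsBasic (.boxP C)

/-- Basic temporal concepts using □F and □P only. -/
inductive TC.IsBasicBox : TC → Prop
  | atom (a : ℕ) : TC.IsBasicBox (.atom a)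
  | boxF {C : TC} : TC.IsBasicBox C → TC.IsBasicBox (.boxF C)
  | boxP {C : TC} : TC.IsBasicBox C → TC.IsBasicBox (.boxP C)

/-- Basic temporal concepts using ○F and ○P only. -/
inductive TC.IsBasicNext : TC → Prop
  | atom (a : ℕ) : TC.IsBasicNext (.atom a)
  | nextF {C : TC} : TC.IsBasicNext C → TC.IsBasicNext (.nextF C)
  | nextP {C : TC} : TC.IsBasicNext C → TC.IsBasicNext (.nextP C)

/-- Positive temporal concepts: no occurrences of ¬. -/
inductive TC.IsPositive : TC → Prop
  | top : TC.IsPositive .top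
  | atom (a : ℕ) : TC.IsPositive (.atom a)
  | and {C D : TC} : TC.IsPositive C → TC.IsPositive D → TC.IsPositive (.and C D)
  | or {C D : TC} : TC.IsPositive C → TC.IsPositive D → TC.IsPositive (.or C D)
  | nextF {C : TC} : TC.IsPositive C → TC.IsPositive (.nextF C)
  | diamF {C : TC} : TC.IsPositive C → TC.IsPositive (.diamF C)
  | boxF {C : TC} : TC.IsPositive C → TC.IsPositive (.boxF C)
  | untl {C D : TC} : TC.IsPositive C → TC.IsPositive D → TC.IsPositive (.untl C D)
  | nextP {C : TC} : TC.IsPositive C → TC.IsPositive (.nextP C)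
  | diamP {C : TC} : TC.IsPositive C → TC.IsPositive (.diamP C)
  | boxP {C : TC} : TC.IsPositive C → TC.IsPositive (.boxP C)
  | since {C D : TC} : TC.IsPositive C → TC.IsPositive D → TC.IsPositive (.since C D)

/-- Prior-LTL formulas: Boolean connectives and □P, ◇P, □F, ◇F only. -/
inductive TC.IsPrior : TC → Prop
  | atom (a : ℕ) : TC.IsPrior (.atom a)
  | neg {C : TC} : TC.IsPrior C → TC.IsPrior (.neg C)
  | and {C D : TC} : TC.IsPrior C → TC.IsPrior D → TC.IsPrior (.and C D)
  | or {C D : TC} : TC.IsPrior C → TC.IsPrior D → TC.IsPrior (.or C D)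
  | boxF {C : TC} : TC.IsPrior C → TC.IsPrior (.boxF C)
  | boxP {C : TC} : TC.IsPrior C → TC.IsPrior (.boxP C)
  | diamF {C : TC} : TC.IsPrior C → TC.IsPrior (.diamF C)
  | diamP {C : TC} : TC.IsPrior C → TC.IsPrior (.diamP C)

/-- Number of occurrences of temporal operators in a temporal concept. -/
def TC.tempOps : TC → ℕ
  | .top => 0
  | .atom _ => 0
  | .neg C => TC.tempOps C
  | .and C D => TC.tempOps C + TC.tempOps D
  | .or C D => TC.tempOps C + TC.tempOps D
  | .nextF C => TC.tempOps C + 1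
  | .diamF C => TC.tempOps C + 1
  | .boxF C => TC.tempOps C + 1
  | .untl C D => TC.tempOps C + TC.tempOps D + 1
  | .nextP C => TC.tempOps C + 1
  | .diamP C => TC.tempOps C + 1
  | .boxP C => TC.tempOps C + 1
  | .since C D => TC.tempOps C + TC.tempOps D + 1

/-- Number of occurrences of symbols in a temporal concept. -/
def TC.size : TC → ℕ
  | .top => 1
  | .atom _ => 1
  | .neg C => TC.size C + 1
  | .and C D => TC.size C + TC.size D + 1
  | .or C D => TC.size C + TC.size D + 1
  | .nextF C => TC.size C + 1
  | .diamF C => TC.size C + 1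
  | .boxF C => TC.size C + 1
  | .untl C D => TC.size C + TC.size D + 1
  | .nextP C => TC.size C + 1
  | .diamP C => TC.size C + 1
  | .boxP C => TC.size C + 1
  | .since C D => TC.size C + TC.size D + 1

/-- The set of subconcepts of a temporal concept. -/
def TC.subs : TC → Set TC
  | .top => {.top}
  | .atom a => {.atom a}
  | .neg C => insert (.neg C) (TC.subs C)
  | .and C D => insert (.and C D) (TC.subs C ∪ TC.subs D)
  | .or C D => insert (.or C D) (TC.subs C ∪ TC.subs D)
  | .nextF C => insert (.nextF C) (TC.subs C)
  | .diamF C => insert (.diamF C) (TC.subs C)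
  | .boxF C => insert (.boxF C) (TC.subs C)
  | .untl C D => insert (.untl C D) (TC.subs C ∪ TC.subs D)
  | .nextP C => insert (.nextP C) (TC.subs C)
  | .diamP C => insert (.diamP C) (TC.subs C)
  | .boxP C => insert (.boxP C) (TC.subs C)
  | .since C D => insert (.since C D) (TC.subs C ∪ TC.subs D)

/-- The set of atomic concepts occurring in a temporal concept. -/
def TC.atoms : TC → Set ℕ
  | .top => ∅
  | .atom a => {a}
  | .neg C => TC.atoms C
  | .and C D => TC.atoms C ∪ TC.atoms D
  | .or C D => TC.atoms C ∪ TC.atoms D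
  | .nextF C => TC.atoms C
  | .diamF C => TC.atoms C
  | .boxF C => TC.atoms C
  | .untl C D => TC.atoms C ∪ TC.atoms D
  | .nextP C => TC.atoms C
  | .diamP C => TC.atoms C
  | .boxP C => TC.atoms C
  | .since C D => TC.atoms C ∪ TC.atoms D

/-! ## Clauses, ontologies, data instances -/

/-- A clause `C₁ ∧ … ∧ C_k → C_{k+1} ∨ … ∨ C_{k+m}`. -/
structure Clause : Type where
  prem : List TC
  concl : List TC

/-- A clause is true in `M` if the intersection of the extensions of the premises
is contained in the union of the extensions of the conclusions. -/
def Clause.holds (M : Itp) (cl : Clause) : Prop :=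
  ∀ n : ℤ, (∀ C ∈ cl.prem, n ∈ TC.sem M C) → ∃ C ∈ cl.concl, n ∈ TC.sem M C

/-- An ontology is a finite set (list) of clauses. -/
abbrev Ontology : Type := List Clause

def Clause.AllBasic (cl : Clause) : Prop :=
  (∀ C ∈ cl.prem, C.IsBasic) ∧ (∀ C ∈ cl.concl, C.IsBasic)

def Clause.AllBasicBox (cl : Clause) : Prop :=
  (∀ C ∈ cl.prem, C.IsBasicBox) ∧ (∀ C ∈ cl.concl, C.IsBasicBox)

def Clause.AllBasicNext (cl : Clause) : Prop :=
  (∀ C ∈ cl.prem, C.IsBasicNext) ∧ (∀ C ∈ cl.concl, C.IsBasicNext)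

/-- Horn: at most one disjunct in the conclusion. -/
def Clause.Horn (cl : Clause) : Prop := cl.concl.length ≤ 1

/-- Krom (binary): at most two concepts altogether. -/
def Clause.Krom (cl : Clause) : Prop := cl.prem.length + cl.concl.length ≤ 2

/-- LTL_bool^□○ ontologies. -/
def Ontology.BoolBoxNext (O : Ontology) : Prop := ∀ cl ∈ O, cl.AllBasic
/-- LTL_bool^□ ontologies. -/
def Ontology.BoolBox (O : Ontology) : Prop := ∀ cl ∈ O, cl.AllBasicBox
/-- LTL_krom^○ ontologies. -/
def Ontology.KromNext (O : Ontology) : Prop := ∀ cl ∈ O, cl.AllBasicNext ∧ cl.Krom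
/-- LTL_krom^□○ ontologies. -/
def Ontology.KromBoxNext (O : Ontology) : Prop := ∀ cl ∈ O, cl.AllBasic ∧ cl.Krom
/-- LTL_horn^□○ ontologies. -/
def Ontology.HornBoxNext (O : Ontology) : Prop := ∀ cl ∈ O, cl.AllBasic ∧ cl.Horn
/-- LTL_horn^□ ontologies. -/
def Ontology.HornBox (O : Ontology) : Prop := ∀ cl ∈ O, cl.AllBasicBox ∧ cl.Horn
/-- LTL_core^□○ ontologies. -/
def Ontology.CoreBoxNext (O : Ontology) : Prop := ∀ cl ∈ O, cl.AllBasic ∧ cl.Horn ∧ cl.Krom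

/-- Number of occurrences of symbols in a clause. -/
def Clause.size (cl : Clause) : ℕ :=
  (cl.prem.map TC.size).sum + (cl.concl.map TC.size).sum + 1

/-- Number of occurrences of symbols in an ontology. -/
def Ontology.size (O : Ontology) : ℕ := (O.map Clause.size).sum

/-- The atomic concept `a` occurs in the ontology `O`. -/
def Ontology.occurs (O : Ontology) (a : ℕ) : Prop :=
  ∃ cl ∈ O, (∃ C ∈ cl.prem, a ∈ C.atoms) ∨ (∃ C ∈ cl.concl, a ∈ C.atoms)

/-- The set of subconcepts of (concepts occurring in) an ontology. -/
def Ontology.subs (O : Ontology) : Set TC :=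
  {C | ∃ cl ∈ O, ∃ D : TC, (D ∈ cl.prem ∨ D ∈ cl.concl) ∧ C ∈ D.subs}

/-- A flat concept: an atomic concept, or a single ○F or ○P applied to an atomic concept. -/
def TC.IsFlat : TC → Prop
  | .atom _ => True
  | .nextF (.atom _) => True
  | .nextP (.atom _) => True
  | _ => False

/-- An ontology without nested temporal operators. -/
def Ontology.Flat (O : Ontology) : Prop :=
  ∀ cl ∈ O, (∀ C ∈ cl.prem, C.IsFlat) ∧ (∀ C ∈ cl.concl, C.IsFlat)

/-- A data instance: a finite nonempty set of timestamped atoms, normalized so that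
the minimal timestamp is 0 and the maximal one is ≥ 1. -/
structure DataInstance : Type where
  atoms : Finset (ℕ × ℤ)
  nonneg : ∀ p ∈ atoms, 0 ≤ p.2
  has_zero : ∃ p ∈ atoms, p.2 = 0
  has_one : ∃ p ∈ atoms, 1 ≤ p.2

theorem DataInstance.ts_nonempty (A : DataInstance) :
    (A.atoms.image Prod.snd).Nonempty := by
  obtain ⟨p, hp, -⟩ := A.has_zero
  exact ⟨p.2, Finset.mem_image_of_mem _ hp⟩

/-- min A: the minimal timestamp occurring in the data instance (equal to 0). -/
def DataInstance.minT (A : DataInstance) : ℤ :=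
  (A.atoms.image Prod.snd).min' A.ts_nonempty

/-- max A: the maximal timestamp occurring in the data instance. -/
def DataInstance.maxT (A : DataInstance) : ℤ :=
  (A.atoms.image Prod.snd).max' A.ts_nonempty

/-- The active temporal domain tem(A). -/
def DataInstance.tem (A : DataInstance) : Set ℤ := Set.Icc A.minT A.maxT

/-- The interpretation of atomic concepts in the first-order structure S_A. -/
def DataInstance.itp (A : DataInstance) : Itp := fun a => {n | (a, n) ∈ A.atoms}

/-- `M` is a model of the knowledge base `(O, A)`. -/
def IsModel (M : Itp) (O : Ontology) (A : DataInstance) : Prop :=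
  (∀ cl ∈ O, cl.holds M) ∧ ∀ p ∈ A.atoms, p.2 ∈ M p.1

/-- The ontology `O` is consistent. -/
def Ontology.Consistent (O : Ontology) : Prop := ∃ M : Itp, ∀ cl ∈ O, cl.holds M

/-- The data instance `A` is consistent with `O`. -/
def ConsistentWith (O : Ontology) (A : DataInstance) : Prop := ∃ M : Itp, IsModel M O A

/-- Certain answers to the OMIQ `(O, κ)` over `A` (within the active domain). -/
def certAns (O : Ontology) (κ : TC) (A : DataInstance) : Set ℤ :=
  {ℓ | ℓ ∈ A.tem ∧ ∀ M : Itp, IsModel M O A → ℓ ∈ TC.sem M κ}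

/-- Certain answers to the OMIQ `(O, κ)` over `A` and ℤ. -/
def certAnsZ (O : Ontology) (κ : TC) (A : DataInstance) : Set ℤ :=
  {ℓ | ∀ M : Itp, IsModel M O A → ℓ ∈ TC.sem M κ}

/-! ## First-order, MSO and FO(RPR) formulas over the temporal structures -/

/-- Formulas of the target languages: first-order variables are indexed by `ℕ`,
as are second-order (set) variables and the recursively defined relation variables
of FO(RPR).  The constructors `qprev j` and `qapp j x` stand for `Q_j(t-1)` (inside
a recursive definition block) and `Q_j(x)`, respectively; `rpr n Θ tv ψ` is the
relational-primitive-recursion construct `[Q₁(t) ≡ Θ₁; …; Q_n(t) ≡ Θ_n] ψ`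
with recursion variable `tv`. -/
inductive Fml : Type where
  | falsum : Fml
  | atom : ℕ → ℕ → Fml        -- A(x)
  | lt : ℕ → ℕ → Fml          -- x < y
  | eq : ℕ → ℕ → Fml          -- x = y
  | succ : ℕ → ℕ → Fml        -- x = y + 1
  | mod : ℕ → ℕ → Fml         -- x ≡ 0 (mod n)
  | svar : ℕ → ℕ → Fml        -- X(x), X a set variable
  | qprev : ℕ → Fml           -- Q_j(t−1)
  | qapp : ℕ → ℕ → Fml        -- Q_j(x)
  | neg : Fml → Fml
  | and : Fml → Fml → Fml
  | or : Fml → Fml → Fml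
  | ex : ℕ → Fml → Fml
  | all : ℕ → Fml → Fml
  | exS : ℕ → Fml → Fml       -- second-order ∃
  | allS : ℕ → Fml → Fml      -- second-order ∀
  | rpr : (n : ℕ) → (Fin n → Fml) → ℕ → Fml → Fml

/-- Evaluation of a formula over the structure with (active) domain `D ⊆ ℤ`
and interpretation `I` of the unary predicates; `env` assigns first-order
variables, `senv` set variables, `prev` the placeholders `Q_j(t-1)` and
`Q` the defined relation variables. First-order quantifiers range over `D`,
second-order quantifiers over subsets of `D`. -/
def Fml.eval (D : Set ℤ) (I : ℕ → Set ℤ) :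
    Fml → (ℕ → ℤ) → (ℕ → Set ℤ) → (ℕ → Prop) → (ℕ → ℤ → Prop) → Prop
  | .falsum, _, _, _, _ => False
  | .atom a x, env, _, _, _ => env x ∈ I a
  | .lt x y, env, _, _, _ => env x < env y
  | .eq x y, env, _, _, _ => env x = env y
  | .succ x y, env, _, _, _ => env x = env y + 1
  | .mod n x, env, _, _, _ => (n : ℤ) ∣ env x
  | .svar X x, env, senv, _, _ => env x ∈ senv X
  | .qprev j, _, _, prev, _ => prev j
  | .qapp j x, env, _, _, Q => Q j (env x)
  | .neg φ, env, senv, prev, Q => ¬ Fml.eval D I φ env senv prev Q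
  | .and φ ψ, env, senv, prev, Q =>
      Fml.eval D I φ env senv prev Q ∧ Fml.eval D I ψ env senv prev Q
  | .or φ ψ, env, senv, prev, Q =>
      Fml.eval D I φ env senv prev Q ∨ Fml.eval D I ψ env senv prev Q
  | .ex x φ, env, senv, prev, Q =>
      ∃ d ∈ D, Fml.eval D I φ (Function.update env x d) senv prev Q
  | .all x φ, env, senv, prev, Q =>
      ∀ d ∈ D, Fml.eval D I φ (Function.update env x d) senv prev Q
  | .exS X φ, env, senv, prev, Q =>
      ∃ S : Set ℤ, S ⊆ D ∧ Fml.eval D I φ env (Function.update senv X S) prev Q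
  | .allS X φ, env, senv, prev, Q =>
      ∀ S : Set ℤ, S ⊆ D → Fml.eval D I φ env (Function.update senv X S) prev Q
  | .rpr n Θ tv ψ, env, senv, prev, Q =>
      -- the semantics of each Θ_j, as a function of the first-order environment
      -- and of the truth values of the `Q_j(t−1)` placeholders
      let f : Fin n → (ℕ → ℤ) → (ℕ → Prop) → Prop :=
        fun j env' prev' => Fml.eval D I (Θ j) env' senv prev' Q
      -- the recursively computed truth values of `Q_j` at time `k` (recursion on k from 0)
      let recQ : ℕ → Fin n → Prop := fun k =>
        Nat.rec (fun j => f j (Function.update env tv 0) (fun _ => False))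
          (fun m ih j => f j (Function.update env tv ((m : ℤ) + 1))
            (fun i => ∃ h : i < n, ih ⟨i, h⟩)) k
      Fml.eval D I ψ env senv prev
        (fun j z => ∃ h : j < n, 0 ≤ z ∧ recQ z.toNat ⟨j, h⟩)

/-- Free first-order variables of a formula. -/
def Fml.fvars : Fml → Set ℕ
  | .falsum => ∅
  | .atom _ x => {x}
  | .lt x y => {x, y}
  | .eq x y => {x, y}
  | .succ x y => {x, y}
  | .mod _ x => {x}
  | .svar _ x => {x}
  | .qprev _ => ∅
  | .qapp _ x => {x}
  | .neg φ => Fml.fvars φ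
  | .and φ ψ => Fml.fvars φ ∪ Fml.fvars ψ
  | .or φ ψ => Fml.fvars φ ∪ Fml.fvars ψ
  | .ex x φ => Fml.fvars φ \ {x}
  | .all x φ => Fml.fvars φ \ {x}
  | .exS _ φ => Fml.fvars φ
  | .allS _ φ => Fml.fvars φ
  | .rpr n Θ tv ψ => (⋃ j : Fin n, Fml.fvars (Θ j) \ {tv}) ∪ Fml.fvars ψ

/-- FO(<)-formulas: first-order logic with the built-in linear order
(and the definable equality predicate); no constants, no arithmetic. -/
def Fml.IsFOlt : Fml → Prop
  | .falsum => True
  | .atom _ _ => True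
  | .lt _ _ => True
  | .eq _ _ => True
  | .neg φ => Fml.IsFOlt φ
  | .and φ ψ => Fml.IsFOlt φ ∧ Fml.IsFOlt ψ
  | .or φ ψ => Fml.IsFOlt φ ∧ Fml.IsFOlt ψ
  | .ex _ φ => Fml.IsFOlt φ
  | .all _ φ => Fml.IsFOlt φ
  | _ => False

/-- FO(<,≡)-formulas: FO(<) extended with the predicates `t ≡ 0 (mod n)`, `n > 1`. -/
def Fml.IsFOltMod : Fml → Prop
  | .falsum => True
  | .atom _ _ => True
  | .lt _ _ => True
  | .eq _ _ => True
  | .mod n _ => 2 ≤ n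
  | .neg φ => Fml.IsFOltMod φ
  | .and φ ψ => Fml.IsFOltMod φ ∧ Fml.IsFOltMod ψ
  | .or φ ψ => Fml.IsFOltMod φ ∧ Fml.IsFOltMod ψ
  | .ex _ φ => Fml.IsFOltMod φ
  | .all _ φ => Fml.IsFOltMod φ
  | _ => False

/-- MSO(<)-formulas: FO(<) extended with set variables and second-order quantifiers. -/
def Fml.IsMSO : Fml → Prop
  | .falsum => True
  | .atom _ _ => True
  | .lt _ _ => True
  | .eq _ _ => True
  | .svar _ _ => True
  | .neg φ => Fml.IsMSO φ
  | .and φ ψ => Fml.IsMSO φ ∧ Fml.IsMSO ψ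
  | .or φ ψ => Fml.IsMSO φ ∧ Fml.IsMSO ψ
  | .ex _ φ => Fml.IsMSO φ
  | .all _ φ => Fml.IsMSO φ
  | .exS _ φ => Fml.IsMSO φ
  | .allS _ φ => Fml.IsMSO φ
  | _ => False

/-- FO(RPR)-formulas: FO(<) extended with successor and relational primitive recursion. -/
def Fml.IsRPR : Fml → Prop
  | .falsum => True
  | .atom _ _ => True
  | .lt _ _ => True
  | .eq _ _ => True
  | .succ _ _ => True
  | .qprev _ => True
  | .qapp _ _ => True
  | .neg φ => Fml.IsRPR φ
  | .and φ ψ => Fml.IsRPR φ ∧ Fml.IsRPR ψ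
  | .or φ ψ => Fml.IsRPR φ ∧ Fml.IsRPR ψ
  | .ex _ φ => Fml.IsRPR φ
  | .all _ φ => Fml.IsRPR φ
  | .rpr n Θ _ ψ => (∀ j : Fin n, Fml.IsRPR (Θ j)) ∧ Fml.IsRPR ψ
  | _ => False

/-- MFO(<)-formulas: monadic first-order formulas built from atoms `A(t)`,
`t < t'`, `t = t'` and `t = t' + 1`. -/
def Fml.IsMFO : Fml → Prop
  | .falsum => True
  | .atom _ _ => True
  | .lt _ _ => True
  | .eq _ _ => True
  | .succ _ _ => True
  | .neg φ => Fml.IsMFO φ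
  | .and φ ψ => Fml.IsMFO φ ∧ Fml.IsMFO ψ
  | .or φ ψ => Fml.IsMFO φ ∧ Fml.IsMFO ψ
  | .ex _ φ => Fml.IsMFO φ
  | .all _ φ => Fml.IsMFO φ
  | _ => False

/-- Quasi-positive MFO(<)-formulas: built from atoms `A(t)`, `t < t'`, `t = t'`,
`t = t' + 1` (and ⊥) using ∧, ∨, ∃, ∀ as well as guarded universal quantification
`∀y (x < y < z → φ)`, `∀y (x < y → φ)`, `∀y (y < z → φ)`
(the guarded implications are encoded via `¬guard ∨ φ`). -/
inductive Fml.IsQP : Fml → Prop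
  | falsum : Fml.IsQP .falsum
  | atom (a x : ℕ) : Fml.IsQP (.atom a x)
  | lt (x y : ℕ) : Fml.IsQP (.lt x y)
  | eq (x y : ℕ) : Fml.IsQP (.eq x y)
  | succ (x y : ℕ) : Fml.IsQP (.succ x y)
  | and {φ ψ : Fml} : Fml.IsQP φ → Fml.IsQP ψ → Fml.IsQP (.and φ ψ)
  | or {φ ψ : Fml} : Fml.IsQP φ → Fml.IsQP ψ → Fml.IsQP (.or φ ψ)
  | ex (x : ℕ) {φ : Fml} : Fml.IsQP φ → Fml.IsQP (.ex x φ)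
  | all (x : ℕ) {φ : Fml} : Fml.IsQP φ → Fml.IsQP (.all x φ)
  | allBtw (y x z : ℕ) {φ : Fml} : Fml.IsQP φ →
      Fml.IsQP (.all y (.or (.neg (.and (.lt x y) (.lt y z))) φ))
  | allGt (y x : ℕ) {φ : Fml} : Fml.IsQP φ →
      Fml.IsQP (.all y (.or (.neg (.lt x y)) φ))
  | allLt (y z : ℕ) {φ : Fml} : Fml.IsQP φ →
      Fml.IsQP (.all y (.or (.neg (.lt y z)) φ))

/-- Evaluation in a structure with domain `D` and unary predicates `I`
(no set variables, placeholders or relation variables supplied). -/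
def Fml.evalIn (D : Set ℤ) (I : Itp) (φ : Fml) (env : ℕ → ℤ) : Prop :=
  Fml.eval D I φ env (fun _ => ∅) (fun _ => False) (fun _ _ => False)

/-- An MFO(<)-formula is monotone if it is preserved under adding time points
to the extensions of the atomic concepts. -/
def MonotoneFml (ψ : Fml) : Prop :=
  ∀ M₁ M₂ : Itp, (∀ a : ℕ, M₁ a ⊆ M₂ a) → ∀ env : ℕ → ℤ,
    Fml.evalIn Set.univ M₁ ψ env → Fml.evalIn Set.univ M₂ ψ env

/-! ## The canonical model of a Horn ontology and a data instance -/

/-- Atoms of the closure: ⊥ or `C(n)` for a (basic) temporal concept `C` and `n ∈ ℤ`. -/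
inductive EAtom : Type where
  | bot : EAtom
  | conc : TC → ℤ → EAtom

/-- One (non-recursive) application of the closure rules of the canonical model. -/
def clStep (O : Ontology) (Λ : Set EAtom) : Set EAtom :=
  Λ ∪
  {e | ∃ cl ∈ O, ∃ n : ℤ, (∀ C ∈ cl.prem, EAtom.conc C n ∈ Λ) ∧
        ((∃ C : TC, cl.concl = [C] ∧ e = EAtom.conc C n) ∨
          (cl.concl = [] ∧ e = EAtom.bot))} ∪
  {e | ∃ C : TC, ∃ n k : ℤ, n < k ∧ EAtom.conc (.boxF C) n ∈ Λ ∧ e = EAtom.conc C k} ∪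
  {e | ∃ C : TC, ∃ n : ℤ, (∀ k : ℤ, n < k → EAtom.conc C k ∈ Λ) ∧
        e = EAtom.conc (.boxF C) n} ∪
  {e | ∃ C : TC, ∃ n : ℤ, EAtom.conc (.nextF C) n ∈ Λ ∧ e = EAtom.conc C (n + 1)} ∪
  {e | ∃ C : TC, ∃ n : ℤ, EAtom.conc C (n + 1) ∈ Λ ∧ e = EAtom.conc (.nextF C) n} ∪
  {e | ∃ C : TC, ∃ n k : ℤ, k < n ∧ EAtom.conc (.boxP C) n ∈ Λ ∧ e = EAtom.conc C k} ∪
  {e | ∃ C : TC, ∃ n : ℤ, (∀ k : ℤ, k < n → EAtom.conc C k ∈ Λ) ∧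
        e = EAtom.conc (.boxP C) n} ∪
  {e | ∃ C : TC, ∃ n : ℤ, EAtom.conc (.nextP C) n ∈ Λ ∧ e = EAtom.conc C (n - 1)} ∪
  {e | ∃ C : TC, ∃ n : ℤ, EAtom.conc C (n - 1) ∈ Λ ∧ e = EAtom.conc (.nextP C) n}

/-- Transfinite iteration of the closure rules. -/
noncomputable def clIter (O : Ontology) (Λ : Set EAtom) (o : Ordinal.{0}) : Set EAtom :=
  Ordinal.limitRecOn o Λ (fun _ ih => clStep O ih)
    (fun o _ ih => ⋃ (o' : Ordinal.{0}), ⋃ (h : o' < o), ih o' h)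

/-- The atoms of a data instance, as a set of closure atoms. -/
def dataAtoms (A : DataInstance) : Set EAtom :=
  {e | ∃ p ∈ A.atoms, e = EAtom.conc (.atom p.1) p.2}

open Ordinal in
/-- The canonical model `C_{O,A}`: the closure of `A` under the rules,
iterated up to the first uncountable ordinal ω₁. -/
noncomputable def canon (O : Ontology) (A : DataInstance) : Set EAtom :=
  clIter O (dataAtoms A) (Ordinal.omega 1)

/-- The canonical model regarded as a temporal interpretation. -/
noncomputable def canonItp (O : Ontology) (A : DataInstance) : Itp :=
  fun a => {n | EAtom.conc (.atom a) n ∈ canon O A}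

/-- The type `τ_{O,A}(n)`: the set of subconcepts of `O` that hold at `n`
in the canonical model. -/
noncomputable def tau (O : Ontology) (A : DataInstance) (n : ℤ) : Set TC :=
  {C ∈ O.subs | n ∈ TC.sem (canonItp O A) C}

/-! ## Literals and the reachability relation ⇝ for Krom ontologies -/

/-- A simple literal: an atomic concept with a polarity. -/
abbrev Lit : Type := ℕ × Bool

/-- The temporal concept corresponding to a literal. -/
def Lit.toTC (L : Lit) : TC := if L.2 then .atom L.1 else .neg (.atom L.1)

def TC.iterF : ℕ → TC → TC
  | 0, C => C
  | k + 1, C => .nextF (TC.iterF k C)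

def TC.iterP : ℕ → TC → TC
  | 0, C => C
  | k + 1, C => .nextP (TC.iterP k C)

/-- `○^k C`: `k` occurrences of ○F if `k > 0`, of ○P if `k < 0`. -/
def TC.shift (k : ℤ) (C : TC) : TC :=
  if 0 ≤ k then TC.iterF k.toNat C else TC.iterP (-k).toNat C

/-- `(L₁,n₁) ⇝ (L₂,n₂)`: in every model of `O`,
`(○^{n₁} L₁)^M ⊆ (○^{n₂} L₂)^M`. -/
def leadsTo (O : Ontology) (L₁ : Lit) (n₁ : ℤ) (L₂ : Lit) (n₂ : ℤ) : Prop :=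
  ∀ M : Itp, (∀ cl ∈ O, cl.holds M) →
    TC.sem M (TC.shift n₁ L₁.toTC) ⊆ TC.sem M (TC.shift n₂ L₂.toTC)



/-! ## Definable relations -/

/-- `Dfn S P`: the relation `P` on assignments into the active domain is uniformly defined by a
single FO(<,≡)-formula with free variables in `S`. -/
def Dfn (S : Set ℕ) (P : DataInstance → (ℕ → ℤ) → Prop) : Prop :=
  ∃ φ : Fml, φ.IsFOltMod ∧ φ.fvars ⊆ S ∧ ∀ (A : DataInstance) (e : ℕ → ℤ),
    (∀ i, e i ∈ A.tem) → (φ.evalIn A.tem A.itp e ↔ P A e)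

theorem DataInstance.minT_eq (A : DataInstance) : A.minT = 0 := by
  apply le_antisymm
  · obtain ⟨p, hp, h0⟩ := A.has_zero
    exact h0 ▸ Finset.min'_le _ _ (Finset.mem_image_of_mem _ hp)
  · apply Finset.le_min'
    intro y hy
    obtain ⟨p, hp, rfl⟩ := Finset.mem_image.1 hy
    exact A.nonneg p hp

theorem DataInstance.mem_tem (A : DataInstance) (n : ℤ) : n ∈ A.tem ↔ 0 ≤ n ∧ n ≤ A.maxT := by
  rw [DataInstance.tem, A.minT_eq, Set.mem_Icc]

theorem DataInstance.snd_mem_tem (A : DataInstance) {p : ℕ × ℤ} (hp : p ∈ A.atoms) :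
    p.2 ∈ A.tem :=
  ⟨Finset.min'_le _ _ (Finset.mem_image_of_mem _ hp),
    Finset.le_max' _ _ (Finset.mem_image_of_mem _ hp)⟩

theorem DataInstance.maxT_nonneg (A : DataInstance) : 0 ≤ A.maxT := by
  obtain ⟨p, hp, -⟩ := A.has_zero
  have := (A.mem_tem _).1 (A.snd_mem_tem hp)
  omega

namespace Dfn

variable {S : Set ℕ} {P Q : DataInstance → (ℕ → ℤ) → Prop}

theorem congr (h : Dfn S P) (hPQ : ∀ A e, (∀ i, e i ∈ A.tem) → (P A e ↔ Q A e)) : Dfn S Q := by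
  obtain ⟨φ, h1, h2, h3⟩ := h
  exact ⟨φ, h1, h2, fun A e he => (h3 A e he).trans (hPQ A e he)⟩

theorem mono {S' : Set ℕ} (h : Dfn S P) (hS : S ⊆ S') : Dfn S' P := by
  obtain ⟨φ, h1, h2, h3⟩ := h
  exact ⟨φ, h1, h2.trans hS, h3⟩

theorem not (h : Dfn S P) : Dfn S (fun A e => ¬ P A e) := by
  obtain ⟨φ, h1, h2, h3⟩ := h
  exact ⟨.neg φ, h1, h2, fun A e he => not_congr (h3 A e he)⟩

theorem and (hP : Dfn S P) (hQ : Dfn S Q) : Dfn S (fun A e => P A e ∧ Q A e) := by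
  obtain ⟨φ, h1, h2, h3⟩ := hP
  obtain ⟨ψ, k1, k2, k3⟩ := hQ
  exact ⟨.and φ ψ, ⟨h1, k1⟩, Set.union_subset h2 k2,
    fun A e he => and_congr (h3 A e he) (k3 A e he)⟩

theorem or (hP : Dfn S P) (hQ : Dfn S Q) : Dfn S (fun A e => P A e ∨ Q A e) := by
  obtain ⟨φ, h1, h2, h3⟩ := hP
  obtain ⟨ψ, k1, k2, k3⟩ := hQ
  exact ⟨.or φ ψ, ⟨h1, k1⟩, Set.union_subset h2 k2,
    fun A e he => or_congr (h3 A e he) (k3 A e he)⟩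

theorem imp (hP : Dfn S P) (hQ : Dfn S Q) : Dfn S (fun A e => P A e → Q A e) :=
  (hP.not.or hQ).congr fun _ _ _ => by tauto

theorem const (p : Prop) : Dfn S (fun _ _ => p) := by
  by_cases hp : p
  · exact ⟨.neg .falsum, trivial, Set.empty_subset _, fun A e _ => by
      simp [Fml.evalIn, Fml.eval, hp]⟩
  · exact ⟨.falsum, trivial, Set.empty_subset _, fun A e _ => by
      simp [Fml.evalIn, Fml.eval, hp]⟩

theorem ex (x : ℕ) (h : Dfn (insert x S) P) :
    Dfn S (fun A e => ∃ d ∈ A.tem, P A (Function.update e x d)) := by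
  obtain ⟨φ, h1, h2, h3⟩ := h
  refine ⟨.ex x φ, h1, ?_, fun A e he => ?_⟩
  · intro y hy
    exact (h2 hy.1).resolve_left hy.2
  · refine exists_congr fun d => and_congr_right fun hd => h3 A _ fun i => ?_
    by_cases hi : i = x
    · subst hi; simpa using hd
    · simpa [Function.update_of_ne hi] using he i

theorem all (x : ℕ) (h : Dfn (insert x S) P) :
    Dfn S (fun A e => ∀ d ∈ A.tem, P A (Function.update e x d)) :=
  (h.not.ex x).not.congr fun _ _ _ => by push Not; rfl

theorem exFin {ι : Type} [Finite ι] {P : ι → DataInstance → (ℕ → ℤ) → Prop}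
    (h : ∀ i, Dfn S (P i)) : Dfn S (fun A e => ∃ i, P i A e) := by
  classical
  have := Fintype.ofFinite ι
  have key : ∀ s : Finset ι, Dfn S (fun A e => ∃ i ∈ s, P i A e) := by
    intro s
    induction s using Finset.induction_on with
    | empty => exact (const False).congr fun _ _ _ => by simp
    | insert i s _ ih => exact ((h i).or ih).congr fun _ _ _ => by simp
  exact (key Finset.univ).congr fun _ _ _ => by simp

theorem allFin {ι : Type} [Finite ι] {P : ι → DataInstance → (ℕ → ℤ) → Prop}
    (h : ∀ i, Dfn S (P i)) : Dfn S (fun A e => ∀ i, P i A e) :=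
  (exFin fun i => (h i).not).not.congr fun _ _ _ => by push Not; rfl

theorem lt {i j : ℕ} (hi : i ∈ S) (hj : j ∈ S) : Dfn S (fun _ e => e i < e j) :=
  ⟨.lt i j, trivial, by simp [Fml.fvars, Set.insert_subset_iff, hi, hj], fun _ _ _ => Iff.rfl⟩

theorem le {i j : ℕ} (hi : i ∈ S) (hj : j ∈ S) : Dfn S (fun _ e => e i ≤ e j) :=
  (lt hj hi).not.congr fun _ _ _ => not_lt

theorem eq {i j : ℕ} (hi : i ∈ S) (hj : j ∈ S) : Dfn S (fun _ e => e i = e j) :=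
  ⟨.eq i j, trivial, by simp [Fml.fvars, Set.insert_subset_iff, hi, hj], fun _ _ _ => Iff.rfl⟩

theorem atom (c : ℕ) {i : ℕ} (hi : i ∈ S) : Dfn S (fun A e => e i ∈ A.itp c) :=
  ⟨.atom c i, trivial, by simp [Fml.fvars, hi], fun _ _ _ => Iff.rfl⟩

theorem dvd {m : ℕ} (hm : 2 ≤ m) {i : ℕ} (hi : i ∈ S) : Dfn S (fun _ e => (m : ℤ) ∣ e i) :=
  ⟨.mod m i, hm, by simp [Fml.fvars, hi], fun _ _ _ => Iff.rfl⟩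

theorem succ {i j : ℕ} (hi : i ∈ S) (hj : j ∈ S) : Dfn S (fun _ e => e j = e i + 1) := by
  have hxi : i ≠ i + j + 1 := by omega
  have hxj : j ≠ i + j + 1 := by omega
  have h1 : Dfn (insert (i + j + 1) S) (fun _ e => e i < e (i + j + 1) ∧ e (i + j + 1) < e j) :=
    (lt (by simp [hi]) (by simp)).and (lt (by simp) (by simp [hj]))
  refine ((lt hi hj).and (h1.ex _).not).congr fun A e he => ?_
  have hi' := (A.mem_tem _).1 (he i)
  have hj' := (A.mem_tem _).1 (he j)
  simp only [Function.update_self, Function.update_of_ne hxi, Function.update_of_ne hxj,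
    A.mem_tem]
  constructor
  · rintro ⟨h, h'⟩
    by_contra hne
    exact h' ⟨e i + 1, by omega, by omega, by omega⟩
  · intro h
    exact ⟨by omega, by rintro ⟨d, hd⟩; omega⟩

theorem dist (r : ℕ) {i j : ℕ} (hi : i ∈ S) (hj : j ∈ S) : Dfn S (fun _ e => e j = e i + r) := by
  induction r generalizing S i j with
  | zero => exact (eq hj hi).congr fun _ _ _ => by simp
  | succ r ih =>
    have hxi : i ≠ i + j + 1 := by omega
    have hxj : j ≠ i + j + 1 := by omega
    have h1 : Dfn (insert (i + j + 1) S)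
        (fun _ e => e (i + j + 1) = e i + r ∧ e j = e (i + j + 1) + 1) :=
      (ih (by simp [hi]) (by simp)).and (succ (by simp) (by simp [hj]))
    refine (h1.ex _).congr fun A e he => ?_
    have hi' := (A.mem_tem _).1 (he i)
    have hj' := (A.mem_tem _).1 (he j)
    simp only [Function.update_self, Function.update_of_ne hxi, Function.update_of_ne hxj,
      A.mem_tem, Nat.cast_succ]
    constructor
    · rintro ⟨d, hd⟩; omega
    · intro h
      exact ⟨e i + r, by omega, by omega, by omega⟩

theorem distGe (r : ℕ) {i j : ℕ} (hi : i ∈ S) (hj : j ∈ S) :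
    Dfn S (fun _ e => e i + r ≤ e j) := by
  have hxi : i ≠ i + j + 1 := by omega
  have hxj : j ≠ i + j + 1 := by omega
  have h1 : Dfn (insert (i + j + 1) S)
      (fun _ e => e (i + j + 1) = e i + r ∧ e (i + j + 1) ≤ e j) :=
    (dist r (by simp [hi]) (by simp)).and (le (by simp) (by simp [hj]))
  refine (h1.ex _).congr fun A e he => ?_
  have hi' := (A.mem_tem _).1 (he i)
  have hj' := (A.mem_tem _).1 (he j)
  simp only [Function.update_self, Function.update_of_ne hxi, Function.update_of_ne hxj,
    A.mem_tem]
  constructor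
  · rintro ⟨d, hd⟩; omega
  · intro h
    exact ⟨e i + r, by omega, by omega, by omega⟩

theorem emod {m : ℕ} (hm : 2 ≤ m) (r : Fin m) {i : ℕ} (hi : i ∈ S) :
    Dfn S (fun _ e => e i % m = r) := by
  have hxi : i ≠ i + 1 := by omega
  have h1 : Dfn (insert (i + 1) S) (fun _ e => (m : ℤ) ∣ e (i + 1) ∧ e i = e (i + 1) + (r : ℕ)) :=
    (dvd hm (by simp)).and (dist r (by simp) (by simp [hi]))
  refine (h1.ex _).congr fun A e he => ?_
  have hi' := (A.mem_tem _).1 (he i)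
  have hr := r.2
  simp only [Function.update_self, Function.update_of_ne hxi, A.mem_tem]
  constructor
  · rintro ⟨d, -, ⟨k, rfl⟩, h⟩
    rw [h, Int.mul_add_emod_self_left, Int.emod_eq_of_lt (by omega) (by omega)]
  · intro h
    have h2 := Int.emod_add_mul_ediv (e i) m
    have h3 : 0 ≤ (m : ℤ) * (e i / m) :=
      mul_nonneg (by omega) (Int.ediv_nonneg hi'.1 (by omega))
    exact ⟨m * (e i / m), ⟨by omega, by omega⟩, dvd_mul_right _ _, by omega⟩

theorem iff_of_modEq {f : ℕ → Prop} {N m : ℕ} (hf : ∀ k, N ≤ k → (f (k + m) ↔ f k)) {k l : ℕ}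
    (hk : N ≤ k) (hl : N ≤ l) (hkl : (k : ℤ) ≡ l [ZMOD m]) : f k ↔ f l := by
  have key : ∀ t k, N ≤ k → (f (k + t * m) ↔ f k) := by
    intro t
    induction t with
    | zero => simp
    | succ t ih =>
      intro k hk
      rw [Nat.succ_mul, ← Nat.add_assoc, hf _ (by omega), ih k hk]
  wlog hle : k ≤ l generalizing k l
  · exact (this hl hk hkl.symm (by omega)).symm
  have h1 : k ≡ l [MOD m] := (Int.natCast_modEq_iff).1 hkl
  obtain ⟨t, ht⟩ := (Nat.modEq_iff_dvd' hle).1 h1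
  have : l = k + t * m := by rw [Nat.mul_comm]; omega
  rw [this, key t k hk]

/-- An eventually periodic condition on the distance of two elements is definable. -/
theorem eventuallyPeriodic {f : ℕ → Prop} {N m : ℕ} (hm : 2 ≤ m)
    (hf : ∀ k, N ≤ k → (f (k + m) ↔ f k)) {i j : ℕ} (hi : i ∈ S) (hj : j ∈ S) :
    Dfn S (fun _ e => e i ≤ e j ∧ f (e j - e i).toNat) := by
  have h1 : Dfn S (fun _ e => ∃ r : Fin N, e j = e i + (r : ℕ) ∧ f r) :=
    exFin fun r => (dist r hi hj).and (const _)
  have h2 : Dfn S (fun _ e => ∃ r₁ r₂ : Fin m, e i % m = r₁ ∧ e j % m = r₂ ∧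
      ∃ k : ℕ, N ≤ k ∧ f k ∧ (k : ℤ) ≡ r₂ - r₁ [ZMOD m]) :=
    exFin fun r₁ => exFin fun r₂ => (emod hm r₁ hi).and ((emod hm r₂ hj).and (const _))
  refine (h1.or ((distGe N hi hj).and h2)).congr fun A e _ => ?_
  constructor
  · rintro (⟨r, hr, hfr⟩ | ⟨hge, r₁, r₂, hr₁, hr₂, k, hk, hfk, hmod⟩)
    · refine ⟨by omega, ?_⟩
      rwa [show (e j - e i).toNat = r by omega]
    · refine ⟨by omega, (iff_of_modEq hf hk (by omega) ?_).1 hfk⟩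
      rw [Int.toNat_of_nonneg (by omega)]
      refine hmod.trans ?_
      rw [← hr₁, ← hr₂]
      exact (Int.mod_modEq _ _).sub (Int.mod_modEq _ _)
  · rintro ⟨hle, hfk⟩
    by_cases hlt : (e j - e i).toNat < N
    · exact Or.inl ⟨⟨_, hlt⟩, by simp; omega, hfk⟩
    · have hm0 : (m : ℤ) ≠ 0 := by omega
      have p₁ := Int.emod_nonneg (e i) hm0
      have p₂ := Int.emod_nonneg (e j) hm0
      have q₁ := Int.emod_lt_of_pos (e i) (b := m) (by omega)
      have q₂ := Int.emod_lt_of_pos (e j) (b := m) (by omega)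
      refine Or.inr ⟨by omega, ⟨(e i % m).toNat, by omega⟩, ⟨(e j % m).toNat, by omega⟩, ?_, ?_,
        _, not_lt.1 hlt, hfk, ?_⟩
      · simp only; omega
      · simp only; omega
      · simp only [Int.toNat_of_nonneg p₁, Int.toNat_of_nonneg p₂]
        rw [Int.toNat_of_nonneg (by omega)]
        exact ((Int.mod_modEq _ _).sub (Int.mod_modEq _ _)).symm

end Dfn

/-! ## Runs of transition relations -/

section Runs

variable {V : Type}

/-- The coordinatewise majority of three truth assignments. -/
def maj (s₁ s₂ s₃ : V → Prop) : V → Prop :=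
  fun v => (s₁ v ∧ s₂ v) ∨ (s₂ v ∧ s₃ v) ∨ (s₁ v ∧ s₃ v)

theorem maj_self (s : V → Prop) : maj s s s = s := by
  funext v
  simp [maj]

/-- Two elements suffice for the Helly property of sets closed under a majority operation. -/
theorem exists_forall_mem_of_majority {α ι : Type} (S : Set α) (m : α → α → α → α)
    (hS : ∀ x ∈ S, ∀ y ∈ S, ∀ z ∈ S, m x y z ∈ S) (sat : ι → α → Prop)
    (h₁₂ : ∀ c x y z, sat c x → sat c y → sat c (m x y z))
    (h₂₃ : ∀ c x y z, sat c y → sat c z → sat c (m x y z))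
    (h₁₃ : ∀ c x y z, sat c x → sat c z → sat c (m x y z))
    (hne : S.Nonempty) (F : Finset ι)
    (hF : ∀ c ∈ F, ∀ d ∈ F, ∃ x ∈ S, sat c x ∧ sat d x) :
    ∃ x ∈ S, ∀ c ∈ F, sat c x := by
  classical
  induction hn : F.card using Nat.strong_induction_on generalizing F with
  | _ n ih =>
    by_cases h3 : 2 < F.card
    · obtain ⟨a, ha, b, hb, c, hc, hab, hac, hbc⟩ := Finset.two_lt_card.1 h3
      have step : ∀ d ∈ F, ∃ x ∈ S, ∀ c ∈ F.erase d, sat c x := fun d hd =>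
        ih _ (by rw [← hn]; exact Finset.card_erase_lt_of_mem hd) _
          (fun c hc c' hc' => hF c (Finset.mem_of_mem_erase hc) c' (Finset.mem_of_mem_erase hc'))
          rfl
      obtain ⟨x, hx, hx'⟩ := step a ha
      obtain ⟨y, hy, hy'⟩ := step b hb
      obtain ⟨z, hz, hz'⟩ := step c hc
      refine ⟨m x y z, hS x hx y hy z hz, fun d hd => ?_⟩
      by_cases hda : d = a
      · exact h₂₃ d x y z (hy' d (by simp [hda, hab, ha])) (hz' d (by simp [hda, hac, ha]))
      · by_cases hdb : d = b
        · exact h₁₃ d x y z (hx' d (by simp [hda, hd])) (hz' d (by simp [hdb, hbc, hb]))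
        · exact h₁₂ d x y z (hx' d (by simp [hda, hd])) (hy' d (by simp [hdb, hd]))
    · by_cases h0 : F = ∅
      · obtain ⟨x, hx⟩ := hne
        exact ⟨x, hx, by simp [h0]⟩
      · by_cases h1 : F.card = 1
        · obtain ⟨c, rfl⟩ := Finset.card_eq_one.1 h1
          obtain ⟨x, hx, hc, -⟩ := hF c (by simp) c (by simp)
          exact ⟨x, hx, by simpa using hc⟩
        · have h2 : F.card = 2 := by
            have := Finset.card_pos.2 (Finset.nonempty_iff_ne_empty.2 h0)
            omega
          obtain ⟨c, d, -, rfl⟩ := Finset.card_eq_two.1 h2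
          obtain ⟨x, hx, hc, hd⟩ := hF c (by simp) d (by simp)
          exact ⟨x, hx, by simpa using ⟨hc, hd⟩⟩

/-- `stepN R k s t`: `t` is reachable from `s` by exactly `k` steps of `R`. -/
def stepN {X : Type} (R : X → X → Prop) : ℕ → X → X → Prop
  | 0 => fun s t => s = t
  | k + 1 => fun s t => ∃ r, stepN R k s r ∧ R r t

theorem stepN_eventuallyPeriodic {X : Type} [Finite X] (R : X → X → Prop) :
    ∃ N m : ℕ, 2 ≤ m ∧ ∀ k, N ≤ k → stepN R (k + m) = stepN R k := by
  obtain ⟨a, b, hab, h⟩ := Finite.exists_ne_map_eq_of_infinite (stepN R)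
  wlog hlt : a < b generalizing a b
  · exact this b a hab.symm h.symm (by omega)
  have key : ∀ k, stepN R (a + k + (b - a)) = stepN R (a + k) := by
    intro k
    induction k with
    | zero => rw [Nat.add_zero, show a + (b - a) = b by omega, h]
    | succ k ih =>
      rw [show a + (k + 1) + (b - a) = (a + k + (b - a)) + 1 by omega,
        show a + (k + 1) = a + k + 1 by omega, stepN, stepN, ih]
  refine ⟨a, (b - a) + (b - a), by omega, fun k hk => ?_⟩
  have h1 := key (k - a)
  have h2 := key (k - a + (b - a))
  rw [show a + (k - a) = k by omega] at h1
  rw [show a + (k - a + (b - a)) = k + (b - a) by omega, h1] at h2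
  rw [← Nat.add_assoc, h2]

/-- `s` is an `R`-path from `u` at time `x` to `w` at time `y`. -/
def IsPath {X : Type} (R : X → X → Prop) (u w : X) (x y : ℤ) (s : ℤ → X) : Prop :=
  s x = u ∧ s y = w ∧ ∀ n, x ≤ n → n < y → R (s n) (s (n + 1))

theorem IsPath.append {X : Type} {R : X → X → Prop} {u w r : X} {x y z : ℤ} {s t : ℤ → X}
    (hs : IsPath R u r x y s) (ht : IsPath R r w y z t) (hxy : x ≤ y) (hyz : y ≤ z) :
    IsPath R u w x z (fun n => if n ≤ y then s n else t n) := by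
  obtain ⟨hs1, hs2, hs3⟩ := hs
  obtain ⟨ht1, ht2, ht3⟩ := ht
  refine ⟨by simp [hxy, hs1], ?_, fun n hn hn' => ?_⟩
  · by_cases h : z ≤ y
    · obtain rfl : y = z := le_antisymm hyz h
      simp [hs2, ← ht1, ht2]
    · simp [h, ht2]
  · by_cases h : n < y
    · simpa [h.le, show n + 1 ≤ y by omega] using hs3 n hn h
    · by_cases h' : n = y
      · subst h'
        simpa [hs2, ht1] using ht3 n le_rfl hn'
      · simpa [show ¬ n ≤ y by omega, show ¬ n + 1 ≤ y by omega] using ht3 n (by omega) hn'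

theorem stepN_iff_exists_isPath {X : Type} (R : X → X → Prop) (k : ℕ) (u w : X) (x : ℤ) :
    stepN R k u w ↔ ∃ s, IsPath R u w x (x + k) s := by
  induction k generalizing w with
  | zero =>
    constructor
    · rintro rfl
      exact ⟨fun _ => u, rfl, rfl, by intro n; simp; omega⟩
    · rintro ⟨s, h1, h2, -⟩
      simpa [stepN, h1] using h2
  | succ k ih =>
    constructor
    · rintro ⟨r, hr, hrw⟩
      obtain ⟨s, hs⟩ := (ih r).1 hr
      have ht : IsPath R r w (x + k) (x + (k + 1 : ℕ))
          (fun n => if n ≤ x + k then r else w) := by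
        refine ⟨by simp, by simp, fun n hn hn' => ?_⟩
        obtain rfl : n = x + k := by push_cast at hn'; omega
        simpa using hrw
      exact ⟨_, hs.append ht (by omega) (by push_cast; omega)⟩
    · rintro ⟨s, h1, h2, h3⟩
      refine ⟨s (x + k), (ih _).2 ⟨s, h1, rfl, fun n hn hn' => h3 n hn (by push_cast; omega)⟩, ?_⟩
      have := h3 (x + k) (by omega) (by push_cast; omega)
      rwa [show x + (k : ℤ) + 1 = x + (k + 1 : ℕ) by push_cast; ring, h2] at this

theorem stepN_toNat_iff {X : Type} (R : X → X → Prop) (u w : X) {x y : ℤ} (hxy : x ≤ y) :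
    stepN R (y - x).toNat u w ↔ ∃ s, IsPath R u w x y s := by
  rw [stepN_iff_exists_isPath R _ u w x, Int.toNat_of_nonneg (by omega), add_sub_cancel]

theorem dfn_stepN {X : Type} [Finite X] (R : X → X → Prop) (u w : X) {S : Set ℕ} {i j : ℕ}
    (hi : i ∈ S) (hj : j ∈ S) :
    Dfn S (fun _ e => e i ≤ e j ∧ ∃ s, IsPath R u w (e i) (e j) s) := by
  obtain ⟨N, m, hm, h⟩ := stepN_eventuallyPeriodic R
  refine (Dfn.eventuallyPeriodic (f := fun k => stepN R k u w) (N := N) hm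
    (fun k hk => by rw [h k hk]) hi hj).congr fun A e _ => ?_
  exact and_congr_right fun hle => stepN_toNat_iff R u w hle

/-- There is an `R`-path from `u` at time `x` to `w` at time `y` obeying the literals `lit`. -/
def HasRun (R : (V → Prop) → (V → Prop) → Prop) (lit : ℤ → V → Bool → Prop)
    (u w : V → Prop) (x y : ℤ) : Prop :=
  ∃ s, IsPath R u w x y s ∧ ∀ n, x ≤ n → n ≤ y → ∀ v b, lit n v b → (s n v ↔ b = true)

/-- A relation on truth assignments preserved by the majority operation. -/
def MajClosed (R : (V → Prop) → (V → Prop) → Prop) : Prop :=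
  ∀ s₁ s₂ s₃ t₁ t₂ t₃, R s₁ t₁ → R s₂ t₂ → R s₃ t₃ → R (maj s₁ s₂ s₃) (maj t₁ t₂ t₃)

theorem hasRun_iff_of_majClosed [Finite V] {R : (V → Prop) → (V → Prop) → Prop}
    (hR : MajClosed R) (lit : ℤ → V → Bool → Prop) (u w : V → Prop) (x y : ℤ) :
    HasRun R lit u w x y ↔ (∃ s, IsPath R u w x y s) ∧
      ∀ p q, x ≤ p → p ≤ q → q ≤ y → ∀ v b v' b', lit p v b → lit q v' b' →
        ∃ s, IsPath R u w x y s ∧ (s p v ↔ b = true) ∧ (s q v' ↔ b' = true) := by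
  classical
  constructor
  · rintro ⟨s, hs, hl⟩
    exact ⟨⟨s, hs⟩, fun p q hp hpq hq v b v' b' h h' =>
      ⟨s, hs, hl p hp (by omega) v b h, hl q (by omega) hq v' b' h'⟩⟩
  · rintro ⟨hne, h2⟩
    have hfin : {c : ℤ × V × Bool | c.1 ∈ Set.Icc x y ∧ lit c.1 c.2.1 c.2.2}.Finite :=
      ((Set.finite_Icc x y).prod (Set.finite_univ (α := V × Bool))).subset
        fun c hc => ⟨hc.1, trivial⟩
    have hclosed : ∀ s₁ ∈ {s | IsPath R u w x y s}, ∀ s₂ ∈ {s | IsPath R u w x y s},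
        ∀ s₃ ∈ {s | IsPath R u w x y s},
          (fun n => maj (s₁ n) (s₂ n) (s₃ n)) ∈ {s | IsPath R u w x y s} := by
      rintro s₁ ⟨a1, a2, a3⟩ s₂ ⟨b1, b2, b3⟩ s₃ ⟨c1, c2, c3⟩
      refine ⟨?_, ?_, fun n hn hn' => hR _ _ _ _ _ _ (a3 n hn hn') (b3 n hn hn') (c3 n hn hn')⟩
      · simp only [a1, b1, c1, maj_self]
      · simp only [a2, b2, c2, maj_self]
    obtain ⟨s, hs, hl⟩ := exists_forall_mem_of_majority {s | IsPath R u w x y s}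
      (fun s₁ s₂ s₃ n => maj (s₁ n) (s₂ n) (s₃ n)) hclosed
      (fun (c : ℤ × V × Bool) s => s c.1 c.2.1 ↔ c.2.2 = true)
      (fun c s₁ s₂ s₃ h h' => by simp only [maj]; tauto)
      (fun c s₁ s₂ s₃ h h' => by simp only [maj]; tauto)
      (fun c s₁ s₂ s₃ h h' => by simp only [maj]; tauto)
      hne hfin.toFinset (by
        rintro ⟨p, v, b⟩ hc ⟨q, v', b'⟩ hd
        simp only [Set.Finite.mem_toFinset, Set.mem_ofPred_eq, Set.mem_Icc] at hc hd
        rcases le_total p q with hpq | hpq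
        · exact h2 p q hc.1.1 hpq hd.1.2 v b v' b' hc.2 hd.2
        · obtain ⟨s, hs, h, h'⟩ := h2 q p hd.1.1 hpq hc.1.2 v' b' v b hd.2 hc.2
          exact ⟨s, hs, h', h⟩)
    exact ⟨s, hs, fun n hn hn' v b hb => hl (n, v, b) (by simpa using ⟨⟨hn, hn'⟩, hb⟩)⟩

theorem exists_isPath_through {X : Type} {R : X → X → Prop} {u w : X} {x p q y : ℤ}
    (hxp : x ≤ p) (hpq : p ≤ q) (hqy : q ≤ y) (P Q : X → Prop) :
    (∃ s, IsPath R u w x y s ∧ P (s p) ∧ Q (s q)) ↔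
      ∃ r t, P r ∧ Q t ∧ (∃ s, IsPath R u r x p s) ∧ (∃ s, IsPath R r t p q s) ∧
        ∃ s, IsPath R t w q y s := by
  constructor
  · rintro ⟨s, ⟨h1, h2, h3⟩, hP, hQ⟩
    exact ⟨s p, s q, hP, hQ, ⟨s, h1, rfl, fun n hn hn' => h3 n hn (by omega)⟩,
      ⟨s, rfl, rfl, fun n hn hn' => h3 n (by omega) (by omega)⟩,
      ⟨s, rfl, h2, fun n hn hn' => h3 n (by omega) (by omega)⟩⟩
  · rintro ⟨r, t, hP, hQ, ⟨s₁, h₁⟩, ⟨s₂, h₂⟩, ⟨s₃, h₃⟩⟩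
    refine ⟨_, (h₁.append h₂ hxp hpq).append h₃ (by omega) hqy, ?_, ?_⟩
    · simpa [hpq, h₁.2.1] using hP
    · have h12 := (h₁.append h₂ hxp hpq).2.1
      rw [← h12] at hQ
      simpa using hQ

variable {lit : DataInstance → ℤ → ℤ → V → Bool → Prop}

theorem dfn_hasRun_of_majClosed [Finite V] {R : (V → Prop) → (V → Prop) → Prop} (hR : MajClosed R)
    (hlit : ∀ (i : ℕ) v b, Dfn {0, i} (fun A e => lit A (e 0) (e i) v b)) (u w : V → Prop)
    {S : Set ℕ} {i j : ℕ} (h0 : 0 ∈ S) (hi : i ∈ S) (hj : j ∈ S) :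
    Dfn S (fun A e => e i ≤ e j ∧ HasRun R (lit A (e 0)) u w (e i) (e j)) := by
  have hip : i ≠ i + j + 1 := by omega
  have hjp : j ≠ i + j + 1 := by omega
  have hiq : i ≠ i + j + 2 := by omega
  have hjq : j ≠ i + j + 2 := by omega
  have hpq : i + j + 1 ≠ i + j + 2 := by omega
  have h0p : 0 ≠ i + j + 1 := by omega
  have h0q : 0 ≠ i + j + 2 := by omega
  generalize hp : i + j + 1 = p at hip hjp hpq h0p
  generalize hq : i + j + 2 = q at hiq hjq hpq h0q
  have hlitS : ∀ {k : ℕ} (v : V) (b : Bool), k ∈ insert q (insert p S) →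
      Dfn (insert q (insert p S)) (fun A e => lit A (e 0) (e k) v b) := fun v b hk =>
    (hlit _ v b).mono (by
      rintro _ (rfl | rfl)
      · simp [h0]
      · exact hk)
  have hpS : p ∈ insert q (insert p S) := by simp
  have hqS : q ∈ insert q (insert p S) := by simp
  have hiS : i ∈ insert q (insert p S) := by simp [hi]
  have hjS : j ∈ insert q (insert p S) := by simp [hj]
  have h1 : Dfn (insert q (insert p S)) (fun A e => (e i ≤ e p ∧ e p ≤ e q ∧ e q ≤ e j) →
      ∀ v b v' b', lit A (e 0) (e p) v b → lit A (e 0) (e q) v' b' →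
        ∃ r t : V → Prop, (r v ↔ b = true) ∧ (t v' ↔ b' = true) ∧
          (e i ≤ e p ∧ ∃ s, IsPath R u r (e i) (e p) s) ∧
          (e p ≤ e q ∧ ∃ s, IsPath R r t (e p) (e q) s) ∧
          (e q ≤ e j ∧ ∃ s, IsPath R t w (e q) (e j) s)) :=
    ((Dfn.le hiS hpS).and ((Dfn.le hpS hqS).and (Dfn.le hqS hjS))).imp <|
      Dfn.allFin fun v => Dfn.allFin fun b => Dfn.allFin fun v' => Dfn.allFin fun b' =>
      (hlitS v b hpS).imp <| (hlitS v' b' hqS).imp <| Dfn.exFin fun r => Dfn.exFin fun t =>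
      (Dfn.const _).and <| (Dfn.const _).and <| (dfn_stepN R u r hiS hpS).and <|
        (dfn_stepN R r t hpS hqS).and (dfn_stepN R t w hqS hjS)
  refine ((dfn_stepN R u w hi hj).and ((h1.all q).all p)).congr fun A e he => ?_
  simp only [Function.update_self, Function.update_of_ne hip, Function.update_of_ne hjp,
    Function.update_of_ne hiq, Function.update_of_ne hjq, Function.update_of_ne hpq,
    Function.update_of_ne h0p, Function.update_of_ne h0q]
  rw [hasRun_iff_of_majClosed hR, and_assoc]
  refine and_congr_right fun hle => and_congr_right fun _ => ?_
  have hi' := (A.mem_tem _).1 (he i)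
  have hj' := (A.mem_tem _).1 (he j)
  constructor
  · intro h p' q' hp' hpq' hq' v b v' b' hv hv'
    obtain ⟨r, t, hr, ht, hA, hB, hC⟩ := h p' ((A.mem_tem _).2 (by omega)) q'
      ((A.mem_tem _).2 (by omega)) ⟨hp', hpq', hq'⟩ v b v' b' hv hv'
    exact (exists_isPath_through hp' hpq' hq' (fun r => r v ↔ b = true)
      (fun t => t v' ↔ b' = true)).2 ⟨r, t, hr, ht, hA.2, hB.2, hC.2⟩
  · rintro h p' - q' - ⟨hp', hpq', hq'⟩ v b v' b' hv hv'
    obtain ⟨r, t, hr, ht, hA, hB, hC⟩ := (exists_isPath_through hp' hpq' hq'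
      (fun r : V → Prop => r v ↔ b = true) (fun t : V → Prop => t v' ↔ b' = true)).1
        (h p' q' hp' hpq' hq' v b v' b' hv hv')
    exact ⟨r, t, hr, ht, ⟨hp', hA⟩, ⟨hpq', hB⟩, ⟨hq', hC⟩⟩

/-- If the labels `T` grow along `R`, a run either keeps its label or factors through the first
step at which the label changes. -/
theorem hasRun_iff_label {R : (V → Prop) → (V → Prop) → Prop} {T : (V → Prop) → Set V}
    (hT : ∀ s t, R s t → T s ⊆ T t) (lit : ℤ → V → Bool → Prop) (u w : V → Prop) {x y : ℤ}
    (hxy : x ≤ y) :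
    HasRun R lit u w x y ↔
      HasRun (fun s t => R s t ∧ T s = T u ∧ T t = T u) lit u w x y ∨
      ∃ u' w', (R u' w' ∧ T u ⊂ T w') ∧ ∃ z, x ≤ z ∧ z + 1 ≤ y ∧
        HasRun (fun s t => R s t ∧ T s = T u ∧ T t = T u) lit u u' x z ∧
        HasRun R lit w' w (z + 1) y := by
  constructor
  · rintro ⟨s, ⟨h1, h2, h3⟩, hl⟩
    by_cases hc : ∀ k : ℕ, x + k ≤ y → T (s (x + k)) = T u
    · refine Or.inl ⟨s, ⟨h1, h2, fun n hn hn' => ⟨h3 n hn hn', ?_, ?_⟩⟩, hl⟩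
      · have := hc (n - x).toNat (by omega)
        rwa [show x + ((n - x).toNat : ℤ) = n by omega] at this
      · have := hc (n + 1 - x).toNat (by omega)
        rwa [show x + ((n + 1 - x).toNat : ℤ) = n + 1 by omega] at this
    · classical
      push Not at hc
      obtain ⟨hk1, hk2⟩ := Nat.find_spec hc
      have hmin := fun k (hk : k < Nat.find hc) => Nat.find_min hc hk
      generalize Nat.find hc = k at hk1 hk2 hmin
      have hk0 : k ≠ 0 := by
        rintro rfl
        exact hk2 (by simp [h1])
      obtain ⟨k, rfl⟩ := Nat.exists_eq_succ_of_ne_zero hk0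
      have hsame : ∀ n, x ≤ n → n ≤ x + k → T (s n) = T u := by
        intro n hn hn'
        have := hmin (n - x).toNat (by omega)
        push Not at this
        have := this (by push_cast at hk1; omega)
        rwa [show x + ((n - x).toNat : ℤ) = n by omega] at this
      have hz : x + (k.succ : ℤ) = x + k + 1 := by push_cast; ring
      rw [hz] at hk1 hk2
      have hstep := h3 (x + k) (by omega) (by omega)
      have hlab := hsame (x + k) (by omega) le_rfl
      refine Or.inr ⟨s (x + k), s (x + k + 1), ⟨hstep, ?_⟩, x + k, by omega, hk1,
        ⟨s, ⟨h1, rfl, fun n hn hn' => ⟨h3 n hn (by omega), hsame n hn (by omega),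
          hsame _ (by omega) (by omega)⟩⟩, fun n hn hn' => hl n hn (by omega)⟩,
        ⟨s, ⟨rfl, h2, fun n hn hn' => h3 n (by omega) hn'⟩, fun n hn hn' => hl n (by omega) hn'⟩⟩
      exact (hlab ▸ hT _ _ hstep).ssubset_of_ne (Ne.symm hk2)
  · rintro (⟨s, ⟨h1, h2, h3⟩, hl⟩ | ⟨u', w', ⟨hR, -⟩, z, hxz, hzy, ⟨s, hs, hsl⟩, ⟨t, ht, htl⟩⟩)
    · exact ⟨s, ⟨h1, h2, fun n hn hn' => (h3 n hn hn').1⟩, hl⟩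
    · obtain ⟨a1, a2, a3⟩ := hs
      obtain ⟨b1, b2, b3⟩ := ht
      refine ⟨fun n => if n ≤ z then s n else t n, ⟨by simp [hxz, a1], ?_, fun n hn hn' => ?_⟩, ?_⟩
      · simp [show ¬ y ≤ z by omega, b2]
      · by_cases h : n < z
        · simpa [h.le, show n + 1 ≤ z by omega] using (a3 n hn h).1
        · by_cases h' : n = z
          · subst h'
            simpa [a2, b1] using hR
          · simpa [show ¬ n ≤ z by omega, show ¬ n + 1 ≤ z by omega] using
              b3 n (by omega) hn'
      · intro n hn hn' v b hb
        by_cases h : n ≤ z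
        · simpa [h] using hsl n hn h v b hb
        · simpa [h] using htl n (by omega) hn' v b hb

theorem dfn_hasRun [Finite V] {R : (V → Prop) → (V → Prop) → Prop} {T : (V → Prop) → Set V}
    (hT : ∀ s t, R s t → T s ⊆ T t)
    (hR : ∀ β, MajClosed (fun s t => R s t ∧ T s = β ∧ T t = β))
    (hlit : ∀ (i : ℕ) v b, Dfn {0, i} (fun A e => lit A (e 0) (e i) v b)) (u w : V → Prop)
    {S : Set ℕ} {i j : ℕ} (h0 : 0 ∈ S) (hi : i ∈ S) (hj : j ∈ S) :
    Dfn S (fun A e => e i ≤ e j ∧ HasRun R (lit A (e 0)) u w (e i) (e j)) := by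
  induction hβ : T u using WellFoundedGT.induction generalizing u S i with
  | _ β ih =>
    subst hβ
    have hip : i ≠ i + j + 1 := by omega
    have hjp : j ≠ i + j + 1 := by omega
    have hiq : i ≠ i + j + 2 := by omega
    have hjq : j ≠ i + j + 2 := by omega
    have hpq : i + j + 1 ≠ i + j + 2 := by omega
    have h0p : 0 ≠ i + j + 1 := by omega
    have h0q : 0 ≠ i + j + 2 := by omega
    generalize hp : i + j + 1 = p at hip hjp hpq h0p
    generalize hq : i + j + 2 = q at hiq hjq hpq h0q
    have h0S : 0 ∈ insert q (insert p S) := by simp [h0]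
    have hpS : p ∈ insert q (insert p S) := by simp
    have hqS : q ∈ insert q (insert p S) := by simp
    have hiS : i ∈ insert q (insert p S) := by simp [hi]
    have hjS : j ∈ insert q (insert p S) := by simp [hj]
    have h1 := dfn_hasRun_of_majClosed (hR (T u)) hlit u w h0 hi hj
    have h2 : Dfn (insert q (insert p S)) (fun A e => ∃ u' w', (R u' w' ∧ T u ⊂ T w') ∧
        e q = e p + 1 ∧
        (e i ≤ e p ∧ HasRun (fun s t => R s t ∧ T s = T u ∧ T t = T u) (lit A (e 0)) u u'
          (e i) (e p)) ∧
        (e q ≤ e j ∧ HasRun R (lit A (e 0)) w' w (e q) (e j))) := by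
      refine Dfn.exFin fun u' => Dfn.exFin fun w' => ?_
      by_cases hc : R u' w' ∧ T u ⊂ T w'
      · exact (Dfn.const _).and <| (Dfn.succ hpS hqS).and <|
          (dfn_hasRun_of_majClosed (hR (T u)) hlit u u' h0S hiS hpS).and
            (ih _ hc.2 w' h0S hqS hjS rfl)
      · exact (Dfn.const False).congr fun _ _ _ => by simp [hc]
    refine (h1.or ((h2.ex q).ex p)).congr fun A e he => ?_
    simp only [Function.update_self, Function.update_of_ne hip, Function.update_of_ne hjp,
      Function.update_of_ne hiq, Function.update_of_ne hjq, Function.update_of_ne hpq,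
      Function.update_of_ne h0p, Function.update_of_ne h0q]
    have hi' := (A.mem_tem _).1 (he i)
    have hj' := (A.mem_tem _).1 (he j)
    constructor
    · rintro (⟨hle, h⟩ | ⟨z, -, z', -, u', w', hc, rfl, ⟨hiz, ha⟩, ⟨hzj, hb⟩⟩)
      · exact ⟨hle, (hasRun_iff_label hT _ _ _ hle).2 (Or.inl h)⟩
      · exact ⟨by omega, (hasRun_iff_label hT _ _ _ (by omega)).2
          (Or.inr ⟨u', w', hc, z, hiz, hzj, ha, hb⟩)⟩
    · rintro ⟨hle, h⟩
      rcases (hasRun_iff_label hT _ _ _ hle).1 h with h | ⟨u', w', hc, z, hiz, hzj, ha, hb⟩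
      · exact Or.inl ⟨hle, h⟩
      · exact Or.inr ⟨z, (A.mem_tem _).2 (by omega), z + 1, (A.mem_tem _).2 (by omega), u', w',
          hc, rfl, ⟨hiz, ha⟩, ⟨hzj, hb⟩⟩

end Runs

/-! ## The transition relation of a Krom ontology -/

section Krom

/-- `L` is a set of basic concepts closed under subconcepts and containing those of `O`. -/
structure Ontology.IsClosure (O : Ontology) (L : Set TC) : Prop where
  basic : ∀ C ∈ L, C.IsBasic
  of_nextF : ∀ C, .nextF C ∈ L → C ∈ L
  of_nextP : ∀ C, .nextP C ∈ L → C ∈ L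
  of_boxF : ∀ C, .boxF C ∈ L → C ∈ L
  of_boxP : ∀ C, .boxP C ∈ L → C ∈ L
  prem : ∀ cl ∈ O, ∀ C ∈ cl.prem, C ∈ L
  concl : ∀ cl ∈ O, ∀ C ∈ cl.concl, C ∈ L

theorem TC.mem_subs_self (C : TC) : C ∈ C.subs := by
  cases C <;> simp [TC.subs]

theorem TC.finite_subs (C : TC) : C.subs.Finite := by
  induction C <;> simp_all [TC.subs]

theorem TC.IsBasic.of_mem_subs {C D : TC} (h : C.IsBasic) (hD : D ∈ C.subs) : D.IsBasic := by
  induction h with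
  | atom a =>
    obtain rfl : D = .atom a := by simpa [TC.subs] using hD
    exact .atom a
  | nextF hC ih =>
    rcases hD with rfl | hD
    exacts [.nextF hC, ih hD]
  | nextP hC ih =>
    rcases hD with rfl | hD
    exacts [.nextP hC, ih hD]
  | boxF hC ih =>
    rcases hD with rfl | hD
    exacts [.boxF hC, ih hD]
  | boxP hC ih =>
    rcases hD with rfl | hD
    exacts [.boxP hC, ih hD]

theorem TC.subs_trans {C D E : TC} (hD : D ∈ C.subs) (hE : E ∈ D.subs) : E ∈ C.subs := by
  induction C with
  | top | atom =>
    simp only [TC.subs, Set.mem_singleton_iff] at hD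
    subst hD
    exact hE
  | _ =>
    simp only [TC.subs, Set.mem_insert_iff, Set.mem_union] at hD ⊢
    rcases hD with rfl | hD
    · simpa [TC.subs] using hE
    · tauto

theorem Ontology.finite_subs (O : Ontology) : O.subs.Finite := by
  have : O.subs = ⋃ cl ∈ {cl | cl ∈ O}, ⋃ D ∈ {D | D ∈ cl.prem ++ cl.concl}, D.subs := by
    ext C
    simp [Ontology.subs]
  rw [this]
  exact (List.finite_toSet O).biUnion fun cl _ =>
    (List.finite_toSet _).biUnion fun D _ => D.finite_subs

theorem Ontology.isClosure_insert_atom {O : Ontology} (hO : ∀ cl ∈ O, cl.AllBasic) (a : ℕ) :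
    O.IsClosure (insert (.atom a) O.subs) := by
  have key : ∀ C D, C ≠ .atom a → D ∈ C.subs → C ∈ insert (.atom a) O.subs →
      D ∈ insert (.atom a) O.subs := by
    rintro C D hne hD (rfl | ⟨cl, hcl, E, hE, hC⟩)
    · exact absurd rfl hne
    · exact Or.inr ⟨cl, hcl, E, hE, TC.subs_trans hC hD⟩
  refine ⟨?_, ?_, ?_, ?_, ?_, ?_, ?_⟩
  · rintro C (rfl | ⟨cl, hcl, E, hE | hE, hC⟩)
    · exact .atom a
    · exact ((hO cl hcl).1 E hE).of_mem_subs hC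
    · exact ((hO cl hcl).2 E hE).of_mem_subs hC
  · exact fun C => key _ _ (by simp) (Or.inr C.mem_subs_self)
  · exact fun C => key _ _ (by simp) (Or.inr C.mem_subs_self)
  · exact fun C => key _ _ (by simp) (Or.inr C.mem_subs_self)
  · exact fun C => key _ _ (by simp) (Or.inr C.mem_subs_self)
  · exact fun cl hcl C hC => Or.inr ⟨cl, hcl, C, Or.inl hC, C.mem_subs_self⟩
  · exact fun cl hcl C hC => Or.inr ⟨cl, hcl, C, Or.inr hC, C.mem_subs_self⟩

variable {O : Ontology} {L : Set TC}

/-- The concept `C` belongs to `L` and is true in the state `s`. -/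
def Holds (s : L → Prop) (C : TC) : Prop := ∃ h : C ∈ L, s ⟨C, h⟩

/-- The states `s` and `t` may label two consecutive time points of a model of `O`. -/
structure Step (O : Ontology) (s t : L → Prop) : Prop where
  clauses : ∀ cl ∈ O, (∀ C ∈ cl.prem, Holds s C) → ∃ C ∈ cl.concl, Holds s C
  nextF : ∀ C, .nextF C ∈ L → (Holds s (.nextF C) ↔ Holds t C)
  nextP : ∀ C, .nextP C ∈ L → (Holds t (.nextP C) ↔ Holds s C)
  boxF : ∀ C, .boxF C ∈ L → (Holds s (.boxF C) ↔ Holds t (.boxF C) ∧ Holds t C)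
  boxP : ∀ C, .boxP C ∈ L → (Holds t (.boxP C) ↔ Holds s (.boxP C) ∧ Holds s C)

/-- The □F-concepts true in a state together with the □P-concepts false in it. -/
def boxLabel (s : L → Prop) : Set L :=
  {v | (∃ D, v.1 = .boxF D) ∧ s v ∨ (∃ D, v.1 = .boxP D) ∧ ¬ s v}

theorem boxF_mem_boxLabel (s : L → Prop) {C : TC} (h : .boxF C ∈ L) :
    ⟨.boxF C, h⟩ ∈ boxLabel s ↔ Holds s (.boxF C) := by
  simp [boxLabel, Holds, h]

theorem boxP_mem_boxLabel (s : L → Prop) {C : TC} (h : .boxP C ∈ L) :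
    ⟨.boxP C, h⟩ ∈ boxLabel s ↔ ¬ Holds s (.boxP C) := by
  simp [boxLabel, Holds, h]

theorem Step.boxLabel_subset {s t : L → Prop} (h : Step O s t) : boxLabel s ⊆ boxLabel t := by
  rintro ⟨C, hC⟩ (⟨⟨D, rfl⟩, hs⟩ | ⟨⟨D, rfl⟩, hs⟩)
  · exact (boxF_mem_boxLabel t hC).2 ((h.boxF D hC).1 ⟨hC, hs⟩).1
  · exact (boxP_mem_boxLabel t hC).2 fun ht => hs ((h.boxP D hC).1 ht).1.2

theorem holds_maj (s₁ s₂ s₃ : L → Prop) (C : TC) :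
    Holds (maj s₁ s₂ s₃) C ↔
      (Holds s₁ C ∧ Holds s₂ C) ∨ (Holds s₂ C ∧ Holds s₃ C) ∨ (Holds s₁ C ∧ Holds s₃ C) := by
  by_cases h : C ∈ L <;> simp [Holds, maj, h]

theorem Clause.Krom.holds_maj {cl : Clause} (hcl : cl.Krom) {s₁ s₂ s₃ : L → Prop}
    (h₁ : (∀ C ∈ cl.prem, Holds s₁ C) → ∃ C ∈ cl.concl, Holds s₁ C)
    (h₂ : (∀ C ∈ cl.prem, Holds s₂ C) → ∃ C ∈ cl.concl, Holds s₂ C)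
    (h₃ : (∀ C ∈ cl.prem, Holds s₃ C) → ∃ C ∈ cl.concl, Holds s₃ C) :
    (∀ C ∈ cl.prem, Holds (maj s₁ s₂ s₃) C) → ∃ C ∈ cl.concl, Holds (maj s₁ s₂ s₃) C := by
  obtain ⟨prem, concl⟩ := cl
  simp only [Clause.Krom] at hcl
  match prem, concl, hcl with
  | [], [], _ => simp at h₁
  | [C], [], _ =>
    simp only [List.mem_singleton, forall_eq, List.not_mem_nil, false_and, exists_false,
      LTLOMQ.holds_maj] at *
    tauto
  | [C, D], [], _ =>
    simp only [List.mem_cons, List.not_mem_nil, forall_eq_or_imp, or_false, forall_eq, false_and,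
      exists_false, LTLOMQ.holds_maj] at *
    tauto
  | [], [C], _ =>
    simp only [List.mem_singleton, exists_eq_left, List.not_mem_nil, false_imp_iff, implies_true,
      true_imp_iff, LTLOMQ.holds_maj] at *
    tauto
  | [], [C, D], _ =>
    simp only [List.mem_cons, List.not_mem_nil, exists_eq_or_imp, or_false, exists_eq_left,
      false_imp_iff, implies_true, true_imp_iff, LTLOMQ.holds_maj] at *
    tauto
  | [C], [D], _ =>
    simp only [List.mem_singleton, forall_eq, exists_eq_left, LTLOMQ.holds_maj] at *
    tauto
  | _ :: _ :: _ :: _, _, h => simp at h; omega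
  | _ :: _ :: _, _ :: _, h => simp at h; omega
  | _ :: _, _ :: _ :: _, h => simp at h; omega
  | _, _ :: _ :: _ :: _, h => simp at h; omega

theorem majClosed_step (hO : ∀ cl ∈ O, cl.Krom) (β : Set L) :
    MajClosed (fun s t : L → Prop => Step O s t ∧ boxLabel s = β ∧ boxLabel t = β) := by
  rintro s₁ s₂ s₃ t₁ t₂ t₃ ⟨h₁, hs₁, ht₁⟩ ⟨h₂, hs₂, ht₂⟩ ⟨h₃, hs₃, ht₃⟩
  have hβ : ∀ r₁ r₂ r₃ : L → Prop, boxLabel r₁ = β → boxLabel r₂ = β → boxLabel r₃ = β →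
      boxLabel (maj r₁ r₂ r₃) = β := by
    intro r₁ r₂ r₃ e₁ e₂ e₃
    ext v
    have i₁ := Set.ext_iff.1 e₁ v
    have i₂ := Set.ext_iff.1 e₂ v
    have i₃ := Set.ext_iff.1 e₃ v
    by_cases hF : ∃ D, v.1 = .boxF D
    · have hP : ¬ ∃ D, v.1 = .boxP D := by
        rintro ⟨D, hD⟩
        obtain ⟨E, hE⟩ := hF
        rw [hE] at hD
        cases hD
      simp only [boxLabel, Set.mem_ofPred_eq, hF, hP, true_and, false_and, or_false, maj] at *
      tauto
    · simp only [boxLabel, Set.mem_ofPred_eq, hF, false_and, false_or, maj] at *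
      tauto
  refine ⟨⟨fun cl hcl => (hO cl hcl).holds_maj (h₁.clauses cl hcl) (h₂.clauses cl hcl)
    (h₃.clauses cl hcl), fun C hC => ?_, fun C hC => ?_, fun C hC => ?_, fun C hC => ?_⟩,
    hβ _ _ _ hs₁ hs₂ hs₃, hβ _ _ _ ht₁ ht₂ ht₃⟩
  · simp only [holds_maj, h₁.nextF C hC, h₂.nextF C hC, h₃.nextF C hC]
  · simp only [holds_maj, h₁.nextP C hC, h₂.nextP C hC, h₃.nextP C hC]
  · have e : ∀ r : L → Prop, boxLabel r = β → (Holds r (.boxF C) ↔ ⟨.boxF C, hC⟩ ∈ β) :=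
      fun r hr => by rw [← hr, boxF_mem_boxLabel]
    have k₁ := h₁.boxF C hC
    have k₂ := h₂.boxF C hC
    have k₃ := h₃.boxF C hC
    simp only [holds_maj, e _ hs₁, e _ hs₂, e _ hs₃, e _ ht₁, e _ ht₂, e _ ht₃] at *
    tauto
  · have e : ∀ r : L → Prop, boxLabel r = β → (Holds r (.boxP C) ↔ ⟨.boxP C, hC⟩ ∉ β) :=
      fun r hr => by rw [← hr, boxP_mem_boxLabel, not_not]
    have k₁ := h₁.boxP C hC
    have k₂ := h₂.boxP C hC
    have k₃ := h₃.boxP C hC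
    simp only [holds_maj, e _ hs₁, e _ hs₂, e _ hs₃, e _ ht₁, e _ ht₂, e _ ht₃] at *
    tauto

/-- `s` evaluates the concept `□P C` correctly at time `n`. -/
def PastFair (s : ℤ → L → Prop) (n : ℤ) : Prop :=
  ∀ C, .boxP C ∈ L → (Holds (s n) (.boxP C) ↔ ∀ k < n, Holds (s k) C)

/-- `s` evaluates the concept `□F C` correctly at time `n`. -/
def FutureFair (s : ℤ → L → Prop) (n : ℤ) : Prop :=
  ∀ C, .boxF C ∈ L → (Holds (s n) (.boxF C) ↔ ∀ k, n < k → Holds (s k) C)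

theorem pastFair_of_le {s : ℤ → L → Prop} (hs : ∀ n, Step O (s n) (s (n + 1))) {m : ℤ}
    (h : ∀ n ≤ m, PastFair s n) (n : ℤ) : PastFair s n := by
  rcases le_total n m with hn | hn
  · exact h n hn
  · induction n, hn using Int.leInduction with
    | base => exact h m le_rfl
    | succ n _ ih =>
      intro C hC
      rw [(hs n).boxP C hC, ih C hC]
      constructor
      · rintro ⟨h1, h2⟩ k hk
        rcases (Int.lt_add_one_iff.1 hk).lt_or_eq with hk | rfl
        exacts [h1 k hk, h2]
      · exact fun h => ⟨fun k hk => h k (by omega), h n (by omega)⟩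

theorem futureFair_of_ge {s : ℤ → L → Prop} (hs : ∀ n, Step O (s n) (s (n + 1))) {m : ℤ}
    (h : ∀ n, m ≤ n → FutureFair s n) (n : ℤ) : FutureFair s n := by
  rcases le_total m n with hn | hn
  · exact h n hn
  · induction n, hn using Int.leInductionDown with
    | base => exact h m le_rfl
    | pred n _ ih =>
      intro C hC
      have := (hs (n - 1)).boxF C hC
      rw [sub_add_cancel] at this
      rw [this, ih C hC]
      constructor
      · rintro ⟨h1, h2⟩ k hk
        by_cases hkn : k = n
        · exact hkn ▸ h2
        · exact h1 k (by omega)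
      · exact fun h => ⟨fun k hk => h k (by omega), h n (by omega)⟩

/-- The interpretation read off a sequence of states. -/
def statesItp (s : ℤ → L → Prop) : Itp := fun c => {n | .atom c ∈ L → Holds (s n) (.atom c)}

theorem mem_sem_statesItp (hL : O.IsClosure L) {s : ℤ → L → Prop}
    (hs : ∀ n, Step O (s n) (s (n + 1))) (hP : ∀ n, PastFair s n) (hF : ∀ n, FutureFair s n)
    {C : TC} (hC : C ∈ L) (n : ℤ) : n ∈ TC.sem (statesItp s) C ↔ Holds (s n) C := by
  have hb := hL.basic C hC
  induction hb generalizing n with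
  | atom c => simp [TC.sem, statesItp, hC]
  | nextF _ ih => exact (ih (hL.of_nextF _ hC) _).trans ((hs n).nextF _ hC).symm
  | nextP _ ih =>
    have := (hs (n - 1)).nextP _ hC
    rw [sub_add_cancel] at this
    exact (ih (hL.of_nextP _ hC) _).trans this.symm
  | boxF _ ih =>
    exact (forall₂_congr fun k _ => ih (hL.of_boxF _ hC) k).trans (hF n _ hC).symm
  | boxP _ ih =>
    exact (forall₂_congr fun k _ => ih (hL.of_boxP _ hC) k).trans (hP n _ hC).symm

theorem holds_statesItp (hL : O.IsClosure L) {s : ℤ → L → Prop}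
    (hs : ∀ n, Step O (s n) (s (n + 1))) (hP : ∀ n, PastFair s n) (hF : ∀ n, FutureFair s n) :
    ∀ cl ∈ O, cl.holds (statesItp s) := by
  intro cl hcl n hn
  obtain ⟨C, hC, h⟩ := (hs n).clauses cl hcl fun C hC =>
    (mem_sem_statesItp hL hs hP hF (hL.prem cl hcl C hC) n).1 (hn C hC)
  exact ⟨C, hC, (mem_sem_statesItp hL hs hP hF (hL.concl cl hcl C hC) n).2 h⟩

/-- The state of an interpretation at a time point. -/
def itpStates (L : Set TC) (M : Itp) : ℤ → L → Prop := fun n v => n ∈ TC.sem M v.1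

theorem holds_itpStates {M : Itp} {n : ℤ} {C : TC} (hC : C ∈ L) :
    Holds (itpStates L M n) C ↔ n ∈ TC.sem M C := by
  simp [Holds, itpStates, hC]

theorem pastFair_itpStates (hL : O.IsClosure L) (M : Itp) (n : ℤ) :
    PastFair (itpStates L M) n := by
  intro C hC
  simp only [holds_itpStates hC, holds_itpStates (hL.of_boxP C hC)]
  rfl

theorem futureFair_itpStates (hL : O.IsClosure L) (M : Itp) (n : ℤ) :
    FutureFair (itpStates L M) n := by
  intro C hC
  simp only [holds_itpStates hC, holds_itpStates (hL.of_boxF C hC)]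
  rfl

theorem step_itpStates (hL : O.IsClosure L) {M : Itp} (hM : ∀ cl ∈ O, cl.holds M) (n : ℤ) :
    Step O (itpStates L M n) (itpStates L M (n + 1)) := by
  refine ⟨fun cl hcl h => ?_, fun C hC => ?_, fun C hC => ?_, fun C hC => ?_, fun C hC => ?_⟩
  · obtain ⟨C, hC, h⟩ := hM cl hcl n fun C hC => (holds_itpStates (hL.prem cl hcl C hC)).1 (h C hC)
    exact ⟨C, hC, (holds_itpStates (hL.concl cl hcl C hC)).2 h⟩
  · rw [holds_itpStates hC, holds_itpStates (hL.of_nextF C hC)]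
    rfl
  · rw [holds_itpStates hC, holds_itpStates (hL.of_nextP C hC)]
    simp [TC.sem]
  · rw [futureFair_itpStates hL M n C hC, futureFair_itpStates hL M (n + 1) C hC]
    constructor
    · exact fun h => ⟨fun k hk => h k (by omega), h _ (by omega)⟩
    · rintro ⟨h1, h2⟩ k hk
      by_cases hkn : k = n + 1
      · exact hkn ▸ h2
      · exact h1 k (by omega)
  · rw [pastFair_itpStates hL M n C hC, pastFair_itpStates hL M (n + 1) C hC]
    constructor
    · exact fun h => ⟨fun k hk => h k (by omega), h _ (by omega)⟩
    · rintro ⟨h1, h2⟩ k hk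
      by_cases hkn : k = n
      · exact hkn ▸ h2
      · exact h1 k (by omega)

/-- The state `u` at time `0` can be extended to the past. -/
def PastExtendable (O : Ontology) (u : L → Prop) : Prop :=
  ∃ s : ℤ → L → Prop, s 0 = u ∧ (∀ n < 0, Step O (s n) (s (n + 1))) ∧ ∀ n ≤ 0, PastFair s n

/-- The state `w` at time `0` can be extended to the future. -/
def FutureExtendable (O : Ontology) (w : L → Prop) : Prop :=
  ∃ s : ℤ → L → Prop, s 0 = w ∧ (∀ n, 0 ≤ n → Step O (s n) (s (n + 1))) ∧
    ∀ n, 0 ≤ n → FutureFair s n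

/-- The literals expressing the data instance `A` and the falsity of `a` at `ℓ`. -/
def queryLit (L : Set TC) (a : ℕ) (A : DataInstance) (ℓ n : ℤ) (v : L) (b : Bool) : Prop :=
  (b = true ∧ ∃ c, v.1 = .atom c ∧ n ∈ A.itp c) ∨ (b = false ∧ v.1 = .atom a ∧ n = ℓ)

theorem exists_countermodel_iff (hL : O.IsClosure L) {a : ℕ} (ha : .atom a ∈ L)
    (A : DataInstance) {ℓ : ℤ} (hℓ : ℓ ∈ A.tem) :
    (∃ M, IsModel M O A ∧ ℓ ∉ M a) ↔
      ∃ u w : L → Prop, PastExtendable O u ∧ FutureExtendable O w ∧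
        HasRun (Step O) (queryLit L a A ℓ) u w 0 A.maxT := by
  constructor
  · rintro ⟨M, ⟨hM, hA⟩, hℓM⟩
    have hs := step_itpStates hL hM
    refine ⟨itpStates L M 0, itpStates L M A.maxT,
      ⟨itpStates L M, rfl, fun n _ => hs n, fun n _ => pastFair_itpStates hL M n⟩,
      ⟨fun n => itpStates L M (A.maxT + n), by simp, fun n _ => ?_, fun n _ C hC => ?_⟩,
      itpStates L M, ⟨rfl, rfl, fun n _ _ => hs n⟩, ?_⟩
    · simpa only [add_assoc] using hs (A.maxT + n)
    · rw [futureFair_itpStates hL M _ C hC]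
      constructor
      · exact fun h k hk => h _ (by omega)
      · intro h k hk
        simpa using h (k - A.maxT) (by omega)
    · rintro n - - ⟨_, hv⟩ b (⟨rfl, c, rfl, hc⟩ | ⟨rfl, rfl, rfl⟩)
      · simpa [itpStates, TC.sem] using hA (c, n) hc
      · simpa [itpStates, TC.sem] using hℓM
  · rintro ⟨u, w, ⟨p, hp0, hp, hpf⟩, ⟨f, hf0, hf, hff⟩, r, ⟨hr0, hrN, hr⟩, hlit⟩
    have hN := A.maxT_nonneg
    generalize hs : (fun n => if n ≤ 0 then p n else if n ≤ A.maxT then r n else f (n - A.maxT))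
      = s
    have sp : ∀ n ≤ 0, s n = p n := fun n hn => by simp [← hs, hn]
    have sr : ∀ n, 0 ≤ n → n ≤ A.maxT → s n = r n := fun n h0 hn => by
      rcases h0.eq_or_lt with rfl | h0
      · rw [sp 0 le_rfl, hp0, hr0]
      · simp [← hs, hn, not_le.2 h0]
    have sf : ∀ n, A.maxT ≤ n → s n = f (n - A.maxT) := fun n hn => by
      rcases hn.eq_or_lt with rfl | hn
      · rw [sr _ hN le_rfl, hrN, sub_self, hf0]
      · simp [← hs, not_le.2 hn, not_le.2 (hN.trans_lt hn)]
    have hstep : ∀ n, Step O (s n) (s (n + 1)) := by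
      intro n
      by_cases h0 : n < 0
      · rw [sp n h0.le, sp (n + 1) (by omega)]
        exact hp n h0
      · by_cases h1 : n < A.maxT
        · rw [sr n (by omega) h1.le, sr (n + 1) (by omega) (by omega)]
          exact hr n (by omega) h1
        · rw [sf n (by omega), sf (n + 1) (by omega), add_sub_right_comm]
          exact hf _ (by omega)
    have hP : ∀ n, PastFair s n := pastFair_of_le hstep (m := 0) fun n hn C hC => by
      rw [sp n hn, hpf n hn C hC]
      exact forall₂_congr fun k hk => by rw [sp k (by omega)]
    have hF : ∀ n, FutureFair s n := futureFair_of_ge hstep (m := A.maxT) fun n hn C hC => by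
      rw [sf n hn, hff _ (by omega) C hC]
      constructor
      · intro h k hk
        rw [sf k (by omega)]
        exact h _ (by omega)
      · intro h k hk
        have := h (k + A.maxT) (by omega)
        rwa [sf _ (by omega), add_sub_cancel_right] at this
    refine ⟨statesItp s, ⟨holds_statesItp hL hstep hP hF, ?_⟩, ?_⟩
    · rintro ⟨c, n⟩ hc hcL
      have hn := (A.mem_tem _).1 (A.snd_mem_tem hc)
      refine ⟨hcL, ?_⟩
      simp only at hn ⊢
      rw [sr n hn.1 hn.2]
      exact (hlit n hn.1 hn.2 ⟨_, hcL⟩ true (Or.inl ⟨rfl, c, rfl, hc⟩)).2 rfl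
    · intro h
      obtain ⟨_, h⟩ := h ha
      have hn := (A.mem_tem _).1 hℓ
      rw [sr ℓ hn.1 hn.2, hlit ℓ hn.1 hn.2 ⟨_, ha⟩ false (Or.inr ⟨rfl, rfl, rfl⟩)] at h
      cases h

theorem dfn_queryLit (a i : ℕ) (v : L) (b : Bool) :
    Dfn {0, i} (fun A e => queryLit L a A (e 0) (e i) v b) := by
  have h : Dfn {0, i} (fun A e => ∃ c, v.1 = .atom c ∧ e i ∈ A.itp c) := by
    by_cases hv : ∃ c, v.1 = .atom c
    · obtain ⟨c, hc⟩ := hv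
      exact (Dfn.atom c (i := i) (by simp)).congr fun A e _ => by simp [hc]
    · push Not at hv
      exact (Dfn.const False).congr fun A e _ => by simp [hv]
  exact ((Dfn.const _).and h).or
    ((Dfn.const _).and ((Dfn.const _).and (Dfn.eq (by simp) (by simp))))

theorem dfn_exists_countermodel (hO : ∀ cl ∈ O, cl.Krom) (hL : O.IsClosure L) (hfin : L.Finite)
    {a : ℕ} (ha : .atom a ∈ L) :
    Dfn {0} (fun A e => ∃ M, IsModel M O A ∧ e 0 ∉ M a) := by
  have := hfin.to_subtype
  have hmin : Dfn {2, 1, 0} (fun A e => ∃ d ∈ A.tem, d < e 1) :=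
    ((Dfn.lt (S := {3, 2, 1, 0}) (i := 3) (j := 1) (by simp) (by simp)).ex 3).congr
      fun A e _ => by simp
  have hmax : Dfn {2, 1, 0} (fun A e => ∃ d ∈ A.tem, e 2 < d) :=
    ((Dfn.lt (S := {3, 2, 1, 0}) (i := 2) (j := 3) (by simp) (by simp)).ex 3).congr
      fun A e _ => by simp
  have h : Dfn {2, 1, 0} (fun A e => ∃ u w : L → Prop,
      (PastExtendable O u ∧ FutureExtendable O w) ∧ (¬ ∃ d ∈ A.tem, d < e 1) ∧
      (¬ ∃ d ∈ A.tem, e 2 < d) ∧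
        e 1 ≤ e 2 ∧ HasRun (Step O) (queryLit L a A (e 0)) u w (e 1) (e 2)) :=
    Dfn.exFin fun u => Dfn.exFin fun w => (Dfn.const _).and <| hmin.not.and <| hmax.not.and <|
      dfn_hasRun (R := Step O) (T := boxLabel) (fun _ _ => Step.boxLabel_subset)
          (majClosed_step hO) (dfn_queryLit a) u w
        (S := {2, 1, 0}) (i := 1) (j := 2) (by simp) (by simp) (by simp)
  refine ((h.ex 2).ex 1).congr fun A e he => ?_
  rw [exists_countermodel_iff hL ha A (he 0)]
  have hN := A.maxT_nonneg
  simp only [Function.update_self, A.mem_tem,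
    Function.update_of_ne (show (0 : ℕ) ≠ 1 by decide),
    Function.update_of_ne (show (0 : ℕ) ≠ 2 by decide),
    Function.update_of_ne (show (1 : ℕ) ≠ 2 by decide)]
  constructor
  · rintro ⟨x, hx, y, hy, u, w, hu, hx0, hyN, -, hrun⟩
    obtain rfl : x = 0 := by
      by_contra hne
      exact hx0 ⟨0, by omega, by omega⟩
    obtain rfl : y = A.maxT := by
      by_contra hne
      exact hyN ⟨A.maxT, by omega, by omega⟩
    exact ⟨u, w, hu.1, hu.2, hrun⟩
  · rintro ⟨u, w, hu, hw, hrun⟩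
    refine ⟨0, by omega, A.maxT, by omega, u, w, ⟨hu, hw⟩, ?_, ?_, hN, hrun⟩
    · rintro ⟨d, hd⟩
      omega
    · rintro ⟨d, hd⟩
      omega

end Krom

/-- FO(<,≡)-rewritability of LTL_krom^□○ OMAQs. -/
theorem kromBoxNext_OMAQ_FOltMod_rewritable (O : Ontology) (hO : O.KromBoxNext) (a : ℕ) :
    ∃ φ : Fml, φ.IsFOltMod ∧ φ.fvars ⊆ {0} ∧
      ∀ A : DataInstance,
        certAns O (.atom a) A = {ℓ ∈ A.tem | Fml.evalIn A.tem A.itp φ (fun _ => ℓ)} := by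
  obtain ⟨φ, h1, h2, h3⟩ := (dfn_exists_countermodel (fun cl hcl => (hO cl hcl).2)
    (Ontology.isClosure_insert_atom (fun cl hcl => (hO cl hcl).1) a) (O.finite_subs.insert _)
    (Set.mem_insert _ _)).not
  refine ⟨φ, h1, h2, fun A => ?_⟩
  ext ℓ
  refine and_congr_right fun hℓ => ?_
  rw [h3 A _ fun _ => hℓ]
  push Not
  rfl

end LTLOMQ
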